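/- arXiv:1910.05990 — 2 statements merged into one kernel-verified Lean document; each statement's English description precedes it below -/
import Mathlib

section
/- If α ≤ nt/2, then there exists a capacity-achieving input distribution P_X (i.e., one with I(X;Y) = C_H(A, αA)) that satisfies the average-power constraint with equality: E[‖X‖₁] = αA. -/
open MeasureTheory ProbabilityTheory Matrix Filter Topology
open scoped ENNReal NNReal BigOperators

noncomputable section

namespace MimoOptical

variable {nt nr : ℕ}

/-- The law of a standard Gaussian vector `Z ~ N(0, I_n)` on `ℝ^n`. -/
def stdGaussian (n : ℕ) : Measure (Fin n → ℝ) :=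
  Measure.pi fun _ => gaussianReal 0 1

/-- Real-valued Kullback–Leibler divergence `∫ log (dμ/dν) dμ`
(with junk value if not absolutely continuous or not integrable). -/
def klDivR {Ω : Type*} [MeasurableSpace Ω] (μ ν : Measure Ω) : ℝ :=
  ∫ ω, Real.log (μ.rnDeriv ν ω).toReal ∂μ

/-- Mutual information of a joint law on a product space: the KL divergence between
the joint law and the product of its marginals. -/
def mutualInfoJoint {β γ : Type*} [MeasurableSpace β] [MeasurableSpace γ]
    (π : Measure (β × γ)) : ℝ :=
  klDivR π ((π.map Prod.fst).prod (π.map Prod.snd))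

/-- Joint law of `(X, H X + Z)` where `X ~ μ` and `Z ~ N(0, I_nr)` is independent of `X`. -/
def jointLaw (H : Matrix (Fin nr) (Fin nt) ℝ) (μ : Measure (Fin nt → ℝ)) :
    Measure ((Fin nt → ℝ) × (Fin nr → ℝ)) :=
  (μ.prod (stdGaussian nr)).map (fun p => (p.1, H.mulVec p.1 + p.2))

/-- An admissible input distribution: a probability measure on `[0, A]^nt`
with average power `E[‖X‖₁] ≤ avg`. -/
def Admissible (nt : ℕ) (A avg : ℝ) (μ : Measure (Fin nt → ℝ)) : Prop :=
  IsProbabilityMeasure μ ∧ (∀ᵐ x ∂μ, ∀ k, x k ∈ Set.Icc (0 : ℝ) A) ∧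
    (∫ x, ∑ k, |x k| ∂μ) ≤ avg

/-- Capacity of the MIMO optical intensity channel with peak power `A` and
average power `avg`. -/
def capacity (H : Matrix (Fin nr) (Fin nt) ℝ) (A avg : ℝ) : ℝ :=
  sSup { c | ∃ μ : Measure (Fin nt → ℝ),
    Admissible nt A avg μ ∧ c = mutualInfoJoint (jointLaw H μ) }

/-- The zonotope `R(M) = { M λ : λ ∈ [0,A]^k }`. -/
def zonotope {n k : ℕ} (M : Matrix (Fin n) (Fin k) ℝ) (A : ℝ) : Set (Fin n → ℝ) :=
  { x | ∃ lam : Fin k → ℝ, (∀ i, lam i ∈ Set.Icc 0 A) ∧ x = M.mulVec lam }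

/-- The collection `𝒰` of `nr`-element subsets of columns that are linearly independent. -/
def goodSets (H : Matrix (Fin nr) (Fin nt) ℝ) : Set (Finset (Fin nt)) :=
  { U | U.card = nr ∧ LinearIndependent ℝ (fun j : {x // x ∈ U} => fun i => H i j.1) }

/-- The square matrix `H_U` whose columns are the columns of `H` indexed by `U`
(junk value, the identity, if `U.card ≠ nr`). -/
def HU (H : Matrix (Fin nr) (Fin nt) ℝ) (U : Finset (Fin nt)) :
    Matrix (Fin nr) (Fin nr) ℝ :=
  if h : U.card = nr then H.submatrix id (fun i => U.orderEmbOfFin h i) else 1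

/-- `a_{U,j} = 1ᵀ H_U⁻¹ h_j`. -/
def aUj (H : Matrix (Fin nr) (Fin nt) ℝ) (U : Finset (Fin nt)) (j : Fin nt) : ℝ :=
  ∑ i, ((HU H U)⁻¹).mulVec (fun r => H r j) i

/-- `g_{U,j} = 1` if `a_{U,j} > 1` and `0` otherwise. -/
def gUj (H : Matrix (Fin nr) (Fin nt) ℝ) (U : Finset (Fin nt)) (j : Fin nt) : ℝ :=
  if 1 < aUj H U j then 1 else 0

/-- `s_U = Σ_{j ∈ Uᶜ} g_{U,j}`. -/
def sU (H : Matrix (Fin nr) (Fin nt) ℝ) (U : Finset (Fin nt)) : ℝ :=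
  ∑ j ∈ Uᶜ, gUj H U j

/-- `v_U = A Σ_{j ∈ Uᶜ} g_{U,j} h_j`. -/
def vU (H : Matrix (Fin nr) (Fin nt) ℝ) (A : ℝ) (U : Finset (Fin nt)) : Fin nr → ℝ :=
  fun r => A * ∑ j ∈ Uᶜ, gUj H U j * H r j

/-- The parallelepiped `D_U = R(H_U)`. -/
def DU (H : Matrix (Fin nr) (Fin nt) ℝ) (A : ℝ) (U : Finset (Fin nt)) :
    Set (Fin nr → ℝ) :=
  zonotope (HU H U) A

/-- The shifted parallelepiped `v_U + D_U`. -/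
def cell (H : Matrix (Fin nr) (Fin nt) ℝ) (A : ℝ) (U : Finset (Fin nt)) :
    Set (Fin nr → ℝ) :=
  (fun d => vU H A U + d) '' DU H A U

/-- `V_H = Σ_{U ∈ 𝒰} |det H_U|`. -/
def VH (H : Matrix (Fin nr) (Fin nt) ℝ) : ℝ :=
  ∑ᶠ U ∈ goodSets H, |(HU H U).det|

/-- `q_U = |det H_U| / V_H`. -/
def qU (H : Matrix (Fin nr) (Fin nt) ℝ) (U : Finset (Fin nt)) : ℝ :=
  |(HU H U).det| / VH H

/-- `α_th = nr/2 + Σ_{U ∈ 𝒰} s_U q_U`. -/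
def alphaTh (H : Matrix (Fin nr) (Fin nt) ℝ) : ℝ :=
  (nr : ℝ) / 2 + ∑ᶠ U ∈ goodSets H, sU H U * qU H U

/-- A probability vector on `𝒰`. -/
def ProbVec (H : Matrix (Fin nr) (Fin nt) ℝ) (p : Finset (Fin nt) → ℝ) : Prop :=
  (∀ U, 0 ≤ p U) ∧ (∀ U, U ∉ goodSets H → p U = 0) ∧ (∑ᶠ U ∈ goodSets H, p U) = 1

/-- Kullback–Leibler divergence `D(p‖q)` between probability vectors on `𝒰`. -/
def Dkl (H : Matrix (Fin nr) (Fin nt) ℝ) (p q : Finset (Fin nt) → ℝ) : ℝ :=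
  ∑ᶠ U ∈ goodSets H, p U * Real.log (p U / q U)

/-- `σ_{U,ℓ}`: square root of the `ℓ`-th diagonal entry of `H_U⁻¹ (H_U⁻¹)ᵀ`. -/
def sigmaUl (H : Matrix (Fin nr) (Fin nt) ℝ) (U : Finset (Fin nt)) (ℓ : Fin nr) : ℝ :=
  Real.sqrt ((((HU H U)⁻¹) * ((HU H U)⁻¹)ᵀ) ℓ ℓ)

/-- The trace of the covariance matrix of `X̄ = H X` when `X ~ μ`. -/
def traceCov (H : Matrix (Fin nr) (Fin nt) ℝ) (μ : Measure (Fin nt → ℝ)) : ℝ :=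
  ∑ i, ((∫ x, (H.mulVec x i) ^ 2 ∂μ) - (∫ x, H.mulVec x i ∂μ) ^ 2)

/-- The Gaussian Q-function. -/
def Qf (x : ℝ) : ℝ :=
  ∫ t in Set.Ioi x, Real.exp (-t ^ 2 / 2) / Real.sqrt (2 * Real.pi)

/-- The high-SNR penalty `ν` due to the average-power constraint. -/
def nuVal (H : Matrix (Fin nr) (Fin nt) ℝ) (α : ℝ) : ℝ :=
  sSup { y | ∃ lam mu : ℝ,
    lam ∈ Set.Ioo (max 0 ((nr : ℝ) / 2 + α - alphaTh H)) (min ((nr : ℝ) / 2) α) ∧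
    0 < mu ∧
    1 / mu - Real.exp (-mu) / (1 - Real.exp (-mu)) = lam / (nr : ℝ) ∧
    y = (nr : ℝ) * (1 - Real.log (mu / (1 - Real.exp (-mu)))
          - mu * Real.exp (-mu) / (1 - Real.exp (-mu)))
        - sInf { d | ∃ p : Finset (Fin nt) → ℝ, ProbVec H p ∧
            (∑ᶠ U ∈ goodSets H, p U * sU H U) = α - lam ∧ d = Dkl H p (qU H) } }

end MimoOptical

namespace MimoOptical

instance (n : ℕ) : IsProbabilityMeasure (stdGaussian n) := by
  unfold stdGaussian; infer_instance

lemma pi_withDensity' {n : ℕ} (μ : Fin n → Measure ℝ) [∀ i, IsProbabilityMeasure (μ i)]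
    (f : Fin n → ℝ → ℝ≥0∞) (hf : ∀ i, Measurable (f i))
    [∀ i, IsProbabilityMeasure ((μ i).withDensity (f i))] :
    Measure.pi (fun i => (μ i).withDensity (f i)) =
      (Measure.pi μ).withDensity (fun x => ∏ i, f i (x i)) := by
  refine Measure.pi_eq fun s hs => ?_
  rw [withDensity_apply _ (MeasurableSet.univ_pi hs),
    ← lintegral_indicator (MeasurableSet.univ_pi hs)]
  have hind : iIndepFun (fun i (x : Fin n → ℝ) => (s i).indicator (f i) (x i)) (Measure.pi μ) :=
    iIndepFun_pi (X := fun i => (s i).indicator (f i))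
      (fun i => ((hf i).indicator (hs i)).aemeasurable)
  have hm : ∀ i, Measurable ((s i).indicator (f i)) := fun i => (hf i).indicator (hs i)
  have key := lintegral_prod_eq_prod_lintegral_of_indepFun Finset.univ _ hind
    (fun i => (hm i).comp (measurable_pi_apply i))
  have e : (Set.univ.pi s).indicator (fun x : Fin n → ℝ => ∏ i, f i (x i))
      = fun x => ∏ i, (s i).indicator (f i) (x i) := by
    funext x
    by_cases hx : x ∈ Set.univ.pi s
    · rw [Set.indicator_of_mem hx]
      refine Finset.prod_congr rfl fun i _ => ?_
      rw [Set.indicator_of_mem (hx i trivial)]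
    · rw [Set.indicator_of_notMem hx]
      simp only [Set.mem_pi, Set.mem_univ, true_imp_iff, not_forall] at hx
      obtain ⟨i, hi⟩ := hx
      exact (Finset.prod_eq_zero (Finset.mem_univ i) (Set.indicator_of_notMem hi _)).symm
  rw [e, key]
  refine Finset.prod_congr rfl fun i _ => ?_
  rw [withDensity_apply _ (hs i), ← lintegral_indicator (hs i),
    ← lintegral_map (μ := Measure.pi μ) (g := fun x : Fin n → ℝ => x i) (hm i)
      (measurable_pi_apply i)]
  rw [(measurePreserving_eval μ i).map_eq]

lemma gaussian_shift (m : ℝ) : (gaussianReal 0 1).map (m + ·) =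
    (gaussianReal 0 1).withDensity (fun y => ENNReal.ofReal (Real.exp (m * y - m ^ 2 / 2))) := by
  rw [gaussianReal_map_const_add, gaussianReal_of_var_ne_zero _ one_ne_zero,
    gaussianReal_of_var_ne_zero _ one_ne_zero, ← withDensity_mul _ (by fun_prop) (by fun_prop)]
  congr 1
  funext y
  simp only [Pi.mul_apply, gaussianPDF]
  rw [← ENNReal.ofReal_mul (gaussianPDFReal_nonneg _ _ _)]
  congr 1
  simp only [gaussianPDFReal]
  rw [mul_assoc _ (Real.exp _) (Real.exp _), ← Real.exp_add]
  congr 2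
  simp
  ring

/-- exponent of the likelihood ratio -/
def LL {nr : ℕ} (m y : Fin nr → ℝ) : ℝ := ∑ i, (m i * y i - m i ^ 2 / 2)

lemma stdGaussian_shift {n : ℕ} (m : Fin n → ℝ) : (stdGaussian n).map (m + ·) =
    (stdGaussian n).withDensity (fun y => ENNReal.ofReal (Real.exp (LL m y))) := by
  have h1 : (stdGaussian n).map (m + ·) =
      Measure.pi (fun i => (gaussianReal 0 1).map (m i + ·)) := by
    unfold stdGaussian
    have : ∀ i, SigmaFinite ((gaussianReal 0 1).map (m i + ·)) := fun i => by
      rw [gaussianReal_map_const_add]; infer_instance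
    exact Measure.pi_map_pi (f := fun i z => m i + z) (fun i => by fun_prop)
  rw [h1]
  simp_rw [gaussian_shift]
  have : ∀ i, IsProbabilityMeasure ((gaussianReal 0 1).withDensity
      (fun y => ENNReal.ofReal (Real.exp (m i * y - m i ^ 2 / 2)))) := fun i => by
    rw [← gaussian_shift, gaussianReal_map_const_add]; infer_instance
  rw [pi_withDensity' _ _ (fun i => by fun_prop)]
  unfold stdGaussian
  congr 1
  funext y
  rw [← ENNReal.ofReal_prod_of_nonneg (fun i _ => (Real.exp_pos _).le), ← Real.exp_sum]
  rfl

lemma stdGaussian_neg (n : ℕ) : (stdGaussian n).map (fun y => -y) = stdGaussian n := by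
  unfold stdGaussian
  have : ∀ _ : Fin n, SigmaFinite ((gaussianReal 0 1).map (fun x => -x)) := fun i => by
    rw [gaussianReal_map_neg]; infer_instance
  have := Measure.pi_map_pi (μ := fun _ : Fin n => gaussianReal 0 1) (f := fun i z => -z)
    (fun i => by fun_prop)
  simp only [gaussianReal_map_neg, neg_zero] at this
  exact this

variable {nt nr : ℕ}

/-- likelihood ratio as an extended nonnegative number -/
def FF (H : Matrix (Fin nr) (Fin nt) ℝ) (p : (Fin nt → ℝ) × (Fin nr → ℝ)) : ℝ≥0∞ :=
  ENNReal.ofReal (Real.exp (LL (H.mulVec p.1) p.2))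

/-- output density with respect to the Gaussian law -/
def QQ (H : Matrix (Fin nr) (Fin nt) ℝ) (μ : Measure (Fin nt → ℝ)) (y : Fin nr → ℝ) : ℝ≥0∞ :=
  ∫⁻ x, FF H (x, y) ∂μ

lemma measurable_mulVec (H : Matrix (Fin nr) (Fin nt) ℝ) :
    Measurable (fun x : Fin nt → ℝ => H.mulVec x) :=
  (Continuous.matrix_mulVec continuous_const continuous_id).measurable

lemma measurable_LL (H : Matrix (Fin nr) (Fin nt) ℝ) :
    Measurable (fun p : (Fin nt → ℝ) × (Fin nr → ℝ) => LL (H.mulVec p.1) p.2) := by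
  have := measurable_mulVec H
  unfold LL
  refine Finset.measurable_sum _ fun i _ => ?_
  have h1 : Measurable (fun p : (Fin nt → ℝ) × (Fin nr → ℝ) => H.mulVec p.1 i) :=
    (measurable_pi_apply i).comp (this.comp measurable_fst)
  have h2 : Measurable (fun p : (Fin nt → ℝ) × (Fin nr → ℝ) => p.2 i) :=
    (measurable_pi_apply i).comp measurable_snd
  exact (h1.mul h2).sub ((h1.pow_const 2).div_const 2)

lemma measurable_FF (H : Matrix (Fin nr) (Fin nt) ℝ) : Measurable (FF H) :=
  (Real.measurable_exp.comp (measurable_LL H)).ennreal_ofReal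

lemma measurable_QQ (H : Matrix (Fin nr) (Fin nt) ℝ) (μ : Measure (Fin nt → ℝ))
    [IsProbabilityMeasure μ] : Measurable (QQ H μ) :=
  (measurable_FF H).lintegral_prod_left'

lemma measurable_chan (H : Matrix (Fin nr) (Fin nt) ℝ) :
    Measurable (fun p : (Fin nt → ℝ) × (Fin nr → ℝ) => (p.1, H.mulVec p.1 + p.2)) :=
  measurable_fst.prodMk (((measurable_mulVec H).comp measurable_fst).add measurable_snd)

instance (H : Matrix (Fin nr) (Fin nt) ℝ) (μ : Measure (Fin nt → ℝ))
    [IsProbabilityMeasure μ] : IsProbabilityMeasure (jointLaw H μ) :=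
  Measure.isProbabilityMeasure_map (measurable_chan H).aemeasurable

lemma inner_shift (H : Matrix (Fin nr) (Fin nt) ℝ)
    (φ : (Fin nt → ℝ) × (Fin nr → ℝ) → ℝ≥0∞) (hφ : Measurable φ) (x : Fin nt → ℝ) :
    ∫⁻ z, φ (x, H.mulVec x + z) ∂(stdGaussian nr) =
      ∫⁻ y, (FF H * φ) (x, y) ∂(stdGaussian nr) := by
  have hx : Measurable (fun y : Fin nr → ℝ => φ (x, y)) := hφ.comp measurable_prodMk_left
  have hFx : Measurable (fun y : Fin nr → ℝ => FF H (x, y)) :=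
    (measurable_FF H).comp measurable_prodMk_left
  have h1 := lintegral_map (μ := stdGaussian nr) hx (measurable_const_add (H.mulVec x))
  have h2 : (stdGaussian nr).map (H.mulVec x + ·) =
    (stdGaussian nr).withDensity (fun y => FF H (x, y)) := stdGaussian_shift _
  have h3 := lintegral_withDensity_eq_lintegral_mul (stdGaussian nr) hFx hx
  rw [← h1, h2, h3]
  simp only [Pi.mul_apply]

lemma jointLaw_eq (H : Matrix (Fin nr) (Fin nt) ℝ) (μ : Measure (Fin nt → ℝ))
    [IsProbabilityMeasure μ] :
    jointLaw H μ = (μ.prod (stdGaussian nr)).withDensity (FF H) := by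
  refine Measure.ext_of_lintegral _ fun φ hφ => ?_
  have hFF := measurable_FF H
  have hc : Measurable (fun p : (Fin nt → ℝ) × (Fin nr → ℝ) => φ (p.1, H.mulVec p.1 + p.2)) :=
    hφ.comp (measurable_chan H)
  rw [jointLaw, lintegral_map hφ (measurable_chan H),
    lintegral_withDensity_eq_lintegral_mul _ hFF hφ,
    lintegral_prod _ hc.aemeasurable,
    lintegral_prod _ (hFF.mul hφ).aemeasurable]
  exact lintegral_congr fun x => inner_shift H φ hφ x

lemma jointLaw_fst (H : Matrix (Fin nr) (Fin nt) ℝ) (μ : Measure (Fin nt → ℝ))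
    [IsProbabilityMeasure μ] : (jointLaw H μ).map Prod.fst = μ := by
  rw [jointLaw, Measure.map_map measurable_fst (measurable_chan H)]
  exact Measure.map_fst_prod.trans (by simp)

lemma jointLaw_snd (H : Matrix (Fin nr) (Fin nt) ℝ) (μ : Measure (Fin nt → ℝ))
    [IsProbabilityMeasure μ] :
    (jointLaw H μ).map Prod.snd = (stdGaussian nr).withDensity (QQ H μ) := by
  refine Measure.ext_of_lintegral _ fun φ hφ => ?_
  have hFF := measurable_FF H
  have h2 : Measurable (fun p : (Fin nt → ℝ) × (Fin nr → ℝ) => φ p.2) := hφ.comp measurable_snd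
  rw [lintegral_map hφ measurable_snd, jointLaw_eq,
    lintegral_withDensity_eq_lintegral_mul _ hFF h2,
    lintegral_withDensity_eq_lintegral_mul _ (measurable_QQ H μ) hφ,
    lintegral_prod_symm' _ (hFF.mul h2)]
  refine lintegral_congr fun y => ?_
  simp only [Pi.mul_apply, QQ]
  exact lintegral_mul_const _ (hFF.comp measurable_prodMk_right)

/-- bound on log densities -/
def Bd (R : ℝ) (y : Fin nr → ℝ) : ℝ := ∑ i, (R * |y i| + R ^ 2 / 2)

lemma abs_LL_le {R : ℝ} {m : Fin nr → ℝ} (hm : ∀ i, |m i| ≤ R) (y : Fin nr → ℝ) :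
    |LL m y| ≤ Bd R y := by
  refine (Finset.abs_sum_le_sum_abs _ _).trans (Finset.sum_le_sum fun i _ => ?_)
  refine (abs_sub _ _).trans (add_le_add ?_ ?_)
  · rw [abs_mul]; exact mul_le_mul_of_nonneg_right (hm i) (abs_nonneg _)
  · rw [abs_of_nonneg (by positivity)]
    have := sq_le_sq' (by linarith [neg_abs_le (m i), hm i]) ((le_abs_self _).trans (hm i))
    linarith

lemma QQ_bounds (H : Matrix (Fin nr) (Fin nt) ℝ) (μ : Measure (Fin nt → ℝ))
    [IsProbabilityMeasure μ] {R : ℝ} (hR : ∀ᵐ x ∂μ, ∀ i, |H.mulVec x i| ≤ R) (y : Fin nr → ℝ) :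
    ENNReal.ofReal (Real.exp (-Bd R y)) ≤ QQ H μ y ∧
      QQ H μ y ≤ ENNReal.ofReal (Real.exp (Bd R y)) := by
  constructor
  · calc _ = ∫⁻ _, ENNReal.ofReal (Real.exp (-Bd R y)) ∂μ := by simp
      _ ≤ _ := lintegral_mono_ae (by
        filter_upwards [hR] with x hx
        exact ENNReal.ofReal_le_ofReal (Real.exp_le_exp.2 (abs_le.1 (abs_LL_le hx y)).1))
  · calc _ ≤ ∫⁻ _, ENNReal.ofReal (Real.exp (Bd R y)) ∂μ := lintegral_mono_ae (by
        filter_upwards [hR] with x hx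
        exact ENNReal.ofReal_le_ofReal (Real.exp_le_exp.2 (abs_le.1 (abs_LL_le hx y)).2))
      _ = _ := by simp

lemma QQ_ne_top (H : Matrix (Fin nr) (Fin nt) ℝ) (μ : Measure (Fin nt → ℝ))
    [IsProbabilityMeasure μ] {R : ℝ} (hR : ∀ᵐ x ∂μ, ∀ i, |H.mulVec x i| ≤ R) (y : Fin nr → ℝ) :
    QQ H μ y ≠ ∞ := ne_top_of_le_ne_top ENNReal.ofReal_ne_top (QQ_bounds H μ hR y).2

lemma QQ_ne_zero (H : Matrix (Fin nr) (Fin nt) ℝ) (μ : Measure (Fin nt → ℝ))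
    [IsProbabilityMeasure μ] {R : ℝ} (hR : ∀ᵐ x ∂μ, ∀ i, |H.mulVec x i| ≤ R) (y : Fin nr → ℝ) :
    QQ H μ y ≠ 0 := by
  have := (QQ_bounds H μ hR y).1
  have h2 : 0 < ENNReal.ofReal (Real.exp (-Bd R y)) := ENNReal.ofReal_pos.2 (Real.exp_pos _)
  exact (h2.trans_le this).ne'

lemma abs_log_QQ (H : Matrix (Fin nr) (Fin nt) ℝ) (μ : Measure (Fin nt → ℝ))
    [IsProbabilityMeasure μ] {R : ℝ} (hR : ∀ᵐ x ∂μ, ∀ i, |H.mulVec x i| ≤ R) (y : Fin nr → ℝ) :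
    |Real.log (QQ H μ y).toReal| ≤ Bd R y := by
  obtain ⟨h1, h2⟩ := QQ_bounds H μ hR y
  have ht := QQ_ne_top H μ hR y
  have h1' := (ENNReal.ofReal_le_iff_le_toReal ht).1 h1
  have h2' := ENNReal.toReal_le_of_le_ofReal (Real.exp_pos _).le h2
  have hp : 0 < (QQ H μ y).toReal := (Real.exp_pos _).trans_le h1'
  exact abs_le.2 ⟨(Real.le_log_iff_exp_le hp).2 h1', (Real.log_le_iff_le_exp hp).2 h2'⟩

/-- information density with a mismatched output law -/
def TT (H : Matrix (Fin nr) (Fin nt) ℝ) (μ : Measure (Fin nt → ℝ))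
    (p : (Fin nt → ℝ) × (Fin nr → ℝ)) : ℝ :=
  LL (H.mulVec p.1) p.2 - Real.log (QQ H μ p.2).toReal

lemma jointLaw_ac (H : Matrix (Fin nr) (Fin nt) ℝ) (μ : Measure (Fin nt → ℝ))
    [IsProbabilityMeasure μ] {R : ℝ} (hR : ∀ᵐ x ∂μ, ∀ i, |H.mulVec x i| ≤ R) :
    jointLaw H μ ≪ ((jointLaw H μ).map Prod.fst).prod ((jointLaw H μ).map Prod.snd) := by
  have hQ := measurable_QQ H μ
  have hFF := measurable_FF H
  have hQ2 : Measurable (fun p : (Fin nt → ℝ) × (Fin nr → ℝ) => QQ H μ p.2) :=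
    hQ.comp measurable_snd
  have hprob : IsProbabilityMeasure ((jointLaw H μ).map Prod.snd) :=
    Measure.isProbabilityMeasure_map measurable_snd.aemeasurable
  have hD : Measurable (fun p : (Fin nt → ℝ) × (Fin nr → ℝ) => FF H p / QQ H μ p.2) := hFF.div hQ2
  have hJ : jointLaw H μ = (((jointLaw H μ).map Prod.fst).prod
      ((jointLaw H μ).map Prod.snd)).withDensity (fun p => FF H p / QQ H μ p.2) := by
    rw [jointLaw_fst, jointLaw_snd, prod_withDensity_right hQ, ← withDensity_mul _ hQ2 hD,
      jointLaw_eq]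
    congr 1
    funext p
    simp only [Pi.mul_apply]
    exact (ENNReal.mul_div_cancel (QQ_ne_zero H μ hR _) (QQ_ne_top H μ hR _)).symm
  conv_lhs => rw [hJ]
  exact withDensity_absolutelyContinuous _ _

lemma mutualInfo_eq (H : Matrix (Fin nr) (Fin nt) ℝ) (μ : Measure (Fin nt → ℝ))
    [IsProbabilityMeasure μ] {R : ℝ} (hR : ∀ᵐ x ∂μ, ∀ i, |H.mulVec x i| ≤ R) :
    mutualInfoJoint (jointLaw H μ) = ∫ p, TT H μ p ∂(jointLaw H μ) := by
  unfold mutualInfoJoint klDivR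
  have hQ := measurable_QQ H μ
  have hFF := measurable_FF H
  have hQ2 : Measurable (fun p : (Fin nt → ℝ) × (Fin nr → ℝ) => QQ H μ p.2) :=
    hQ.comp measurable_snd
  have hprob : IsProbabilityMeasure ((jointLaw H μ).map Prod.snd) :=
    Measure.isProbabilityMeasure_map measurable_snd.aemeasurable
  have hD : Measurable (fun p : (Fin nt → ℝ) × (Fin nr → ℝ) => FF H p / QQ H μ p.2) := hFF.div hQ2
  have hJ : jointLaw H μ = (((jointLaw H μ).map Prod.fst).prod
      ((jointLaw H μ).map Prod.snd)).withDensity (fun p => FF H p / QQ H μ p.2) := by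
    rw [jointLaw_fst, jointLaw_snd, prod_withDensity_right hQ, ← withDensity_mul _ hQ2 hD,
      jointLaw_eq]
    congr 1
    funext p
    simp only [Pi.mul_apply]
    exact (ENNReal.mul_div_cancel (QQ_ne_zero H μ hR _) (QQ_ne_top H μ hR _)).symm
  have hprob1 : IsProbabilityMeasure ((jointLaw H μ).map Prod.fst) :=
    Measure.isProbabilityMeasure_map measurable_fst.aemeasurable
  have hrn := Measure.rnDeriv_withDensity (((jointLaw H μ).map Prod.fst).prod
      ((jointLaw H μ).map Prod.snd)) hD
  rw [← hJ] at hrn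
  have hac := jointLaw_ac H μ hR
  refine integral_congr_ae ?_
  filter_upwards [hac.ae_le hrn] with p hp
  rw [hp, ENNReal.toReal_div, Real.log_div]
  · rw [FF, ENNReal.toReal_ofReal (Real.exp_pos _).le, Real.log_exp]; rfl
  · rw [FF, ENNReal.toReal_ofReal (Real.exp_pos _).le]; exact (Real.exp_pos _).ne'
  · exact ENNReal.toReal_ne_zero.2 ⟨QQ_ne_zero H μ hR _, QQ_ne_top H μ hR _⟩

lemma measurable_TT (H : Matrix (Fin nr) (Fin nt) ℝ) (μ : Measure (Fin nt → ℝ))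
    [IsProbabilityMeasure μ] : Measurable (TT H μ) :=
  (measurable_LL H).sub
    (Real.measurable_log.comp ((measurable_QQ H μ).comp measurable_snd).ennreal_toReal)

/-- integrable envelope on the noise space -/
def Bz (R : ℝ) (z : Fin nr → ℝ) : ℝ := 2 * ∑ i, (R * (R + |z i|) + R ^ 2 / 2)

lemma integrable_Bz (R : ℝ) : Integrable (Bz (nr := nr) R) (stdGaussian nr) := by
  unfold Bz
  refine Integrable.const_mul (integrable_finsetSum _ fun i _ => ?_) 2
  have h0 : Integrable (fun t : ℝ => R * (R + |t|) + R ^ 2 / 2) (gaussianReal 0 1) := by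
    have h1 : Integrable (fun t : ℝ => t) (gaussianReal 0 1) :=
      (memLp_id_gaussianReal (μ := 0) (v := 1) 1).integrable (by simp)
    exact (((integrable_const R).add h1.abs).const_mul R).add (integrable_const _)
  exact (measurePreserving_eval (fun _ : Fin nr => gaussianReal 0 1) i).integrable_comp_of_integrable h0

lemma TT_chan_bound (H : Matrix (Fin nr) (Fin nt) ℝ) (μ ν : Measure (Fin nt → ℝ))
    [IsProbabilityMeasure μ] [IsProbabilityMeasure ν] {R : ℝ} (hR0 : 0 ≤ R)
    (hR : ∀ᵐ x ∂μ, ∀ i, |H.mulVec x i| ≤ R) (hRν : ∀ᵐ x ∂ν, ∀ i, |H.mulVec x i| ≤ R) :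
    ∀ᵐ p ∂(μ.prod (stdGaussian nr)), ‖TT H ν (p.1, H.mulVec p.1 + p.2)‖ ≤ Bz R p.2 := by
  have := (Measure.quasiMeasurePreserving_fst (μ := μ) (ν := stdGaussian nr)).ae hR
  filter_upwards [this] with p hp
  have h1 := abs_LL_le hp (H.mulVec p.1 + p.2)
  have h2 := abs_log_QQ H ν hRν (H.mulVec p.1 + p.2)
  have h3 : Bd R (H.mulVec p.1 + p.2) ≤ ∑ i, (R * (R + |p.2 i|) + R ^ 2 / 2) := by
    refine Finset.sum_le_sum fun i _ => ?_
    have : |(H.mulVec p.1 + p.2) i| ≤ R + |p.2 i| :=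
      (abs_add_le _ _).trans (add_le_add (hp i) le_rfl)
    have := mul_le_mul_of_nonneg_left this hR0
    linarith
  rw [Real.norm_eq_abs]
  unfold TT Bz
  have h4 := abs_sub (LL (H.mulVec p.1) (H.mulVec p.1 + p.2))
    (Real.log (QQ H ν (H.mulVec p.1 + p.2)).toReal)
  dsimp only
  linarith

lemma integrable_TT (H : Matrix (Fin nr) (Fin nt) ℝ) (μ ν : Measure (Fin nt → ℝ))
    [IsProbabilityMeasure μ] [IsProbabilityMeasure ν] {R : ℝ} (hR0 : 0 ≤ R)
    (hR : ∀ᵐ x ∂μ, ∀ i, |H.mulVec x i| ≤ R) (hRν : ∀ᵐ x ∂ν, ∀ i, |H.mulVec x i| ≤ R) :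
    Integrable (TT H ν) (jointLaw H μ) := by
  rw [jointLaw, integrable_map_measure (measurable_TT H ν).aestronglyMeasurable
    (measurable_chan H).aemeasurable]
  exact Integrable.mono' ((integrable_Bz R).comp_snd μ)
    ((measurable_TT H ν).comp (measurable_chan H)).aestronglyMeasurable
    (TT_chan_bound H μ ν hR0 hR hRν)

lemma integral_TT_le (H : Matrix (Fin nr) (Fin nt) ℝ) (μ ν : Measure (Fin nt → ℝ))
    [IsProbabilityMeasure μ] [IsProbabilityMeasure ν] {R : ℝ} (hR0 : 0 ≤ R)
    (hR : ∀ᵐ x ∂μ, ∀ i, |H.mulVec x i| ≤ R) (hRν : ∀ᵐ x ∂ν, ∀ i, |H.mulVec x i| ≤ R) :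
    ∫ p, TT H ν p ∂(jointLaw H μ) ≤ ∫ z, Bz R z ∂(stdGaussian nr) := by
  rw [jointLaw, integral_map (measurable_chan H).aemeasurable
    (measurable_TT H ν).aestronglyMeasurable]
  have h1 := norm_integral_le_of_norm_le ((integrable_Bz R).comp_snd μ)
    (TT_chan_bound H μ ν hR0 hR hRν)
  rw [integral_fun_snd] at h1
  simp only [probReal_univ, one_smul] at h1
  exact (le_abs_self _).trans h1

lemma cross (H : Matrix (Fin nr) (Fin nt) ℝ) (μ ν : Measure (Fin nt → ℝ))
    [IsProbabilityMeasure μ] [IsProbabilityMeasure ν] {R : ℝ} (hR0 : 0 ≤ R)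
    (hR : ∀ᵐ x ∂μ, ∀ i, |H.mulVec x i| ≤ R) (hRν : ∀ᵐ x ∂ν, ∀ i, |H.mulVec x i| ≤ R) :
    ∫ p, TT H μ p ∂(jointLaw H μ) ≤ ∫ p, TT H ν p ∂(jointLaw H μ) := by
  have hQ1 := measurable_QQ H μ
  have hQ2 := measurable_QQ H ν
  have hW : Measurable (fun y => QQ H ν y / QQ H μ y) := hQ2.div hQ1
  have hone : ∫⁻ p, QQ H ν p.2 / QQ H μ p.2 ∂(jointLaw H μ) = 1 := by
    have e1 := lintegral_map (μ := jointLaw H μ) hW measurable_snd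
    rw [← e1, jointLaw_snd, lintegral_withDensity_eq_lintegral_mul _ hQ1 hW]
    have e2 : (QQ H μ * fun y => QQ H ν y / QQ H μ y) = QQ H ν := by
      funext y
      simp only [Pi.mul_apply]
      exact ENNReal.mul_div_cancel (QQ_ne_zero H μ hR _) (QQ_ne_top H μ hR _)
    rw [e2]
    have : IsProbabilityMeasure ((jointLaw H ν).map Prod.snd) :=
      Measure.isProbabilityMeasure_map measurable_snd.aemeasurable
    have e3 := measure_univ (μ := (jointLaw H ν).map Prod.snd)
    rw [jointLaw_snd, withDensity_apply _ MeasurableSet.univ, Measure.restrict_univ] at e3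
    exact e3
  have hWm : Measurable (fun p : (Fin nt → ℝ) × (Fin nr → ℝ) => QQ H ν p.2 / QQ H μ p.2) :=
    hW.comp measurable_snd
  have hint : Integrable (fun p : (Fin nt → ℝ) × (Fin nr → ℝ) =>
      (QQ H ν p.2 / QQ H μ p.2).toReal) (jointLaw H μ) :=
    integrable_toReal_of_lintegral_ne_top hWm.aemeasurable (by rw [hone]; simp)
  have hval : ∫ p, (QQ H ν p.2 / QQ H μ p.2).toReal ∂(jointLaw H μ) = 1 := by
    rw [integral_toReal hWm.aemeasurable
      (ae_lt_top hWm (by rw [hone]; simp)), hone]; simp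
  have i1 := integrable_TT H μ μ hR0 hR hR
  have i2 := integrable_TT H μ ν hR0 hR hRν
  have hle : ∫ p, (1 - (QQ H ν p.2 / QQ H μ p.2).toReal) ∂(jointLaw H μ) ≤
      ∫ p, (TT H ν p - TT H μ p) ∂(jointLaw H μ) := by
    refine integral_mono ((integrable_const _).sub hint) (i2.sub i1) fun p => ?_
    have p1 := ENNReal.toReal_pos (QQ_ne_zero H μ hR p.2) (QQ_ne_top H μ hR p.2)
    have p2 := ENNReal.toReal_pos (QQ_ne_zero H ν hRν p.2) (QQ_ne_top H ν hRν p.2)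
    have h3 := Real.log_le_sub_one_of_pos (div_pos p2 p1)
    rw [Real.log_div p2.ne' p1.ne'] at h3
    simp only [TT, ENNReal.toReal_div]
    linarith
  rw [integral_sub (integrable_const _) hint, integral_sub i2 i1, hval] at hle
  simp at hle
  exact hle

lemma jointLaw_mix (H : Matrix (Fin nr) (Fin nt) ℝ) (μ ν : Measure (Fin nt → ℝ))
    [IsProbabilityMeasure μ] [IsProbabilityMeasure ν] (a b : ℝ≥0) :
    jointLaw H (a • μ + b • ν) = a • jointLaw H μ + b • jointLaw H ν := by
  unfold jointLaw
  rw [Measure.add_prod, Measure.prod_smul_left, Measure.prod_smul_left,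
    Measure.map_add _ _ (measurable_chan H), Measure.map_smul, Measure.map_smul]

lemma mix_ge (H : Matrix (Fin nr) (Fin nt) ℝ) (μ ν : Measure (Fin nt → ℝ))
    [IsProbabilityMeasure μ] [IsProbabilityMeasure ν] (a b : ℝ≥0)
    [IsProbabilityMeasure (a • μ + b • ν)] {R : ℝ} (hR0 : 0 ≤ R)
    (hR : ∀ᵐ x ∂μ, ∀ i, |H.mulVec x i| ≤ R) (hRν : ∀ᵐ x ∂ν, ∀ i, |H.mulVec x i| ≤ R)
    (hRm : ∀ᵐ x ∂(a • μ + b • ν), ∀ i, |H.mulVec x i| ≤ R) :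
    a * mutualInfoJoint (jointLaw H μ) + b * mutualInfoJoint (jointLaw H ν) ≤
      mutualInfoJoint (jointLaw H (a • μ + b • ν)) := by
  rw [mutualInfo_eq H μ hR, mutualInfo_eq H ν hRν, mutualInfo_eq H _ hRm]
  have j1 := integrable_TT H μ _ hR0 hR hRm
  have j2 := integrable_TT H ν _ hR0 hRν hRm
  have e : ∫ p, TT H (a • μ + b • ν) p ∂(jointLaw H (a • μ + b • ν)) =
      a * ∫ p, TT H (a • μ + b • ν) p ∂(jointLaw H μ) +
      b * ∫ p, TT H (a • μ + b • ν) p ∂(jointLaw H ν) := by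
    rw [jointLaw_mix, integral_add_measure (j1.smul_measure_nnreal) (j2.smul_measure_nnreal),
      integral_smul_nnreal_measure, integral_smul_nnreal_measure]
    rfl
  rw [e]
  exact add_le_add (mul_le_mul_of_nonneg_left (cross H μ _ hR0 hR hRm) a.2)
    (mul_le_mul_of_nonneg_left (cross H ν _ hR0 hRν hRm) b.2)

lemma klDivR_map {Ω Ω' : Type*} [MeasurableSpace Ω] [MeasurableSpace Ω'] (e : Ω ≃ᵐ Ω')
    (μ ν : Measure Ω) [IsProbabilityMeasure μ] [IsProbabilityMeasure ν] (hac : μ ≪ ν) :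
    klDivR (μ.map e) (ν.map e) = klDivR μ ν := by
  unfold klDivR
  rw [integral_map_equiv]
  refine integral_congr_ae ?_
  filter_upwards [hac.ae_le (e.measurableEmbedding.rnDeriv_map μ ν)] with x hx
  rw [hx]

lemma jointLaw_reflect (H : Matrix (Fin nr) (Fin nt) ℝ) (μ : Measure (Fin nt → ℝ))
    [IsProbabilityMeasure μ] (c : Fin nt → ℝ) :
    jointLaw H (μ.map (fun x => c - x)) =
      (jointLaw H μ).map (Prod.map (fun x => c - x) (fun y => H.mulVec c - y)) := by
  have hm1 : Measurable (fun x : Fin nt → ℝ => c - x) := by fun_prop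
  have hm2 : Measurable (fun y : Fin nr → ℝ => H.mulVec c - y) := by fun_prop
  have hn : Measurable (fun y : Fin nr → ℝ => -y) := by fun_prop
  unfold jointLaw
  conv_lhs => rw [← stdGaussian_neg nr]
  rw [Measure.map_prod_map _ _ hm1 hn, Measure.map_map (measurable_chan H) (hm1.prodMap hn),
    Measure.map_map (hm1.prodMap hm2) (measurable_chan H)]
  congr 1
  funext p
  simp only [Function.comp, Prod.map]
  rw [Matrix.mulVec_sub]
  congr 1
  abel

lemma mutualInfo_reflect (H : Matrix (Fin nr) (Fin nt) ℝ) (μ : Measure (Fin nt → ℝ))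
    [IsProbabilityMeasure μ] {R : ℝ} (hR : ∀ᵐ x ∂μ, ∀ i, |H.mulVec x i| ≤ R) (c : Fin nt → ℝ) :
    mutualInfoJoint (jointLaw H (μ.map (fun x => c - x))) = mutualInfoJoint (jointLaw H μ) := by
  have hm1 : Measurable (fun x : Fin nt → ℝ => c - x) := by fun_prop
  have hm2 : Measurable (fun y : Fin nr → ℝ => H.mulVec c - y) := by fun_prop
  have p1 : IsProbabilityMeasure ((jointLaw H μ).map Prod.fst) :=
    Measure.isProbabilityMeasure_map measurable_fst.aemeasurable
  have p2 : IsProbabilityMeasure ((jointLaw H μ).map Prod.snd) :=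
    Measure.isProbabilityMeasure_map measurable_snd.aemeasurable
  rw [jointLaw_reflect]
  unfold mutualInfoJoint
  have e1 : ((jointLaw H μ).map (Prod.map (fun x => c - x) (fun y => H.mulVec c - y))).map Prod.fst
      = ((jointLaw H μ).map Prod.fst).map (fun x => c - x) := by
    rw [Measure.map_map measurable_fst (hm1.prodMap hm2), Measure.map_map hm1 measurable_fst]
    rfl
  have e2 : ((jointLaw H μ).map (Prod.map (fun x => c - x) (fun y => H.mulVec c - y))).map Prod.snd
      = ((jointLaw H μ).map Prod.snd).map (fun y => H.mulVec c - y) := by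
    rw [Measure.map_map measurable_snd (hm1.prodMap hm2), Measure.map_map hm2 measurable_snd]
    rfl
  rw [e1, e2, Measure.map_prod_map _ _ hm1 hm2]
  exact klDivR_map (MeasurableEquiv.prodCongr (MeasurableEquiv.subLeft c)
    (MeasurableEquiv.subLeft (H.mulVec c))) _ _ (jointLaw_ac H μ hR)

lemma exists_bound (H : Matrix (Fin nr) (Fin nt) ℝ) {A : ℝ} (hA : 0 < A) :
    ∃ R : ℝ, 0 ≤ R ∧ ∀ x : Fin nt → ℝ, (∀ k, x k ∈ Set.Icc (0 : ℝ) A) →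
      ∀ i, |H.mulVec x i| ≤ R := by
  refine ⟨∑ i, ∑ j, |H i j| * A, by positivity, fun x hx i => ?_⟩
  have h1 : |H.mulVec x i| ≤ ∑ j, |H i j| * A := by
    have e : H.mulVec x i = ∑ j, H i j * x j := rfl
    rw [e]
    refine (Finset.abs_sum_le_sum_abs _ _).trans (Finset.sum_le_sum fun j _ => ?_)
    rw [abs_mul]
    exact mul_le_mul_of_nonneg_left (abs_le.2 ⟨by linarith [(hx j).1], (hx j).2⟩) (abs_nonneg _)
  have h2 : ∀ i ∈ (Finset.univ : Finset (Fin nr)), (0 : ℝ) ≤ ∑ j, |H i j| * A :=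
    fun i _ => by positivity
  exact h1.trans (Finset.single_le_sum h2 (Finset.mem_univ i))

lemma integrable_power {A : ℝ} (μ : Measure (Fin nt → ℝ)) [IsProbabilityMeasure μ]
    (hbox : ∀ᵐ x ∂μ, ∀ k, x k ∈ Set.Icc (0 : ℝ) A) :
    Integrable (fun x : Fin nt → ℝ => ∑ k, |x k|) μ := by
  refine integrable_finsetSum _ fun k _ => ?_
  refine Integrable.mono' (integrable_const A)
    (by fun_prop : Measurable fun x : Fin nt → ℝ => |x k|).aestronglyMeasurable ?_
  filter_upwards [hbox] with x hx
  rw [Real.norm_eq_abs, abs_abs]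
  exact abs_le.2 ⟨by linarith [(hx k).1, (hx k).2], (hx k).2⟩

lemma power_reflect {A : ℝ} (μ : Measure (Fin nt → ℝ)) [IsProbabilityMeasure μ]
    (hbox : ∀ᵐ x ∂μ, ∀ k, x k ∈ Set.Icc (0 : ℝ) A) :
    ∫ x, ∑ k, |x k| ∂(μ.map (fun x => (fun _ => A) - x)) = nt * A - ∫ x, ∑ k, |x k| ∂μ := by
  have hm : Measurable (fun x : Fin nt → ℝ => (fun _ => A) - x) := by fun_prop
  rw [integral_map hm.aemeasurable
    (by fun_prop : Measurable fun x : Fin nt → ℝ => ∑ k, |x k|).aestronglyMeasurable]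
  have e : ∫ x : Fin nt → ℝ, ∑ k, |((fun _ => A) - x : Fin nt → ℝ) k| ∂μ
      = ∫ x, (nt * A - ∑ k, |x k|) ∂μ := by
    refine integral_congr_ae ?_
    filter_upwards [hbox] with x hx
    have : ∀ k, |((fun _ => A) - x : Fin nt → ℝ) k| = A - |x k| := fun k => by
      rw [Pi.sub_apply, abs_of_nonneg (by linarith [(hx k).2]), abs_of_nonneg (hx k).1]
    simp only [this, Finset.sum_sub_distrib]
    simp
  rw [e, integral_sub (integrable_const _) (integrable_power μ hbox)]
  simp

end MimoOptical

/-- If `α ≤ nt/2`, there exists a capacity-achieving input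
distribution satisfying the average-power constraint with equality. -/
theorem MimoOptical.exists_capacityAchieving_avgPower_eq
    (nt nr : ℕ) (hnr : 1 ≤ nr) (hntnr : nr < nt)
    (H : Matrix (Fin nr) (Fin nt) ℝ) (hrank : H.rank = nr)
    (A α : ℝ) (hA : 0 < A) (hα : 0 < α) (h : α ≤ (nt : ℝ) / 2)
    (hach : ∃ μ : Measure (Fin nt → ℝ), MimoOptical.Admissible nt A (α * A) μ ∧
      MimoOptical.mutualInfoJoint (MimoOptical.jointLaw H μ) =
        MimoOptical.capacity H A (α * A)) :
    ∃ μ : Measure (Fin nt → ℝ), MimoOptical.Admissible nt A (α * A) μ ∧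
      MimoOptical.mutualInfoJoint (MimoOptical.jointLaw H μ) =
        MimoOptical.capacity H A (α * A) ∧
      (∫ x, ∑ k, |x k| ∂μ) = α * A := by
  classical
  obtain ⟨μ, ⟨hμp, hbox, hpow⟩, hI⟩ := hach
  obtain ⟨R, hR0, hRx⟩ := MimoOptical.exists_bound H hA
  have hR : ∀ᵐ x ∂μ, ∀ i, |H.mulVec x i| ≤ R := hbox.mono fun x hx => hRx x hx
  -- the capacity is an actual upper bound
  have hcap : ∀ ν : Measure (Fin nt → ℝ), MimoOptical.Admissible nt A (α * A) ν →
      MimoOptical.mutualInfoJoint (MimoOptical.jointLaw H ν) ≤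
        MimoOptical.capacity H A (α * A) := by
    intro ν hν
    refine le_csSup ⟨∫ z, MimoOptical.Bz R z ∂(MimoOptical.stdGaussian nr), ?_⟩ ⟨ν, hν, rfl⟩
    rintro c ⟨ρ, ⟨hρp, hρb, -⟩, rfl⟩
    have hRρ : ∀ᵐ x ∂ρ, ∀ i, |H.mulVec x i| ≤ R := hρb.mono fun x hx => hRx x hx
    rw [MimoOptical.mutualInfo_eq H ρ hRρ]
    exact MimoOptical.integral_TT_le H ρ ρ hR0 hRρ hRρ
  -- reflected input
  have hm : Measurable (fun x : Fin nt → ℝ => (fun _ => A) - x) := by fun_prop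
  obtain ⟨μ', hμ'⟩ : ∃ μ', μ' = μ.map (fun x : Fin nt → ℝ => (fun _ => A) - x) := ⟨_, rfl⟩
  have hμ'p : IsProbabilityMeasure μ' := by
    rw [hμ']; exact Measure.isProbabilityMeasure_map hm.aemeasurable
  have hI' : MimoOptical.mutualInfoJoint (MimoOptical.jointLaw H μ') =
      MimoOptical.capacity H A (α * A) := by
    rw [hμ', MimoOptical.mutualInfo_reflect H μ hR, hI]
  have hpow' : ∫ x, ∑ k, |x k| ∂μ' = nt * A - ∫ x, ∑ k, |x k| ∂μ := by
    rw [hμ']; exact MimoOptical.power_reflect μ hbox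
  have hmeas : MeasurableSet {x : Fin nt → ℝ | ∀ k, x k ∈ Set.Icc (0 : ℝ) A} := by
    rw [Set.ofPred_forall]
    exact MeasurableSet.iInter fun k => measurable_pi_apply k measurableSet_Icc
  have hbox' : ∀ᵐ x ∂μ', ∀ k, x k ∈ Set.Icc (0 : ℝ) A := by
    rw [hμ', ae_map_iff hm.aemeasurable hmeas]
    filter_upwards [hbox] with x hx k
    have := hx k
    simp only [Pi.sub_apply, Set.mem_Icc] at this ⊢
    constructor <;> linarith
  -- mixing weight
  obtain ⟨E, hE⟩ : ∃ E, E = ∫ x, ∑ k, |x k| ∂μ := ⟨_, rfl⟩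
  rw [← hE] at hpow hpow'
  have hhalf : α * A ≤ nt * A - α * A := by nlinarith
  obtain ⟨t, ht0, ht1, ht⟩ : ∃ t : ℝ, 0 ≤ t ∧ t ≤ 1 ∧ t * E + (1 - t) * (nt * A - E) = α * A := by
    rcases hpow.eq_or_lt with heq | hlt
    · exact ⟨1, by norm_num, le_rfl, by linarith⟩
    · have hd : 0 < nt * A - E - E := by linarith
      refine ⟨(nt * A - E - α * A) / (nt * A - E - E), div_nonneg (by linarith) hd.le,
        (div_le_one hd).2 (by linarith), ?_⟩
      field_simp
      ring
  obtain ⟨a, b, ha, hb⟩ : ∃ a b : ℝ≥0, (a : ℝ) = t ∧ (b : ℝ) = 1 - t :=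
    ⟨⟨t, ht0⟩, ⟨1 - t, by linarith⟩, rfl, rfl⟩
  have hab : a + b = 1 := by
    apply NNReal.coe_injective; push_cast; rw [ha, hb]; ring
  have hmp : IsProbabilityMeasure (a • μ + b • μ') := by
    constructor
    rw [Measure.add_apply, Measure.smul_apply, Measure.smul_apply, measure_univ, measure_univ]
    simp only [ENNReal.smul_def, smul_eq_mul, mul_one]
    exact_mod_cast hab
  have hmbox : ∀ᵐ x ∂(a • μ + b • μ'), ∀ k, x k ∈ Set.Icc (0 : ℝ) A := by
    rw [ae_add_measure_iff]
    exact ⟨Measure.ae_smul_measure hbox a, Measure.ae_smul_measure hbox' b⟩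
  have hmpow : ∫ x, ∑ k, |x k| ∂(a • μ + b • μ') = α * A := by
    rw [integral_add_measure
      ((MimoOptical.integrable_power μ hbox).smul_measure_nnreal)
      ((MimoOptical.integrable_power μ' hbox').smul_measure_nnreal),
      integral_smul_nnreal_measure, integral_smul_nnreal_measure, hpow', ← hE,
      NNReal.smul_def, NNReal.smul_def, ha, hb]
    exact ht
  have hadm : MimoOptical.Admissible nt A (α * A) (a • μ + b • μ') := ⟨hmp, hmbox, hmpow.le⟩
  refine ⟨a • μ + b • μ', hadm, le_antisymm (hcap _ hadm) ?_, hmpow⟩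
  have hge := MimoOptical.mix_ge H μ μ' a b hR0 hR (hbox'.mono fun x hx => hRx x hx)
    (hmbox.mono fun x hx => hRx x hx)
  rw [hI, hI', ha, hb] at hge
  linarith
end
end

section
/- For arbitrary α > 0, C_H(A, αA) ≤ sup over probability vectors p on 𝒰 of [ log V_H − D(p‖q) + Σ_{U∈𝒰} p_U Σ_{ℓ=1}^{nr} log(σ_{U,ℓ} + A/√(2πe)) ]. -/
open MeasureTheory ProbabilityTheory Matrix Filter Topology
open scoped ENNReal NNReal BigOperators

noncomputable section

namespace MimoOptical

variable {nt nr : ℕ}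
/-! ### One-dimensional output density -/

/-- Logarithmic tail correction of the one-dimensional output density. -/
def pen (A v t : ℝ) : ℝ :=
  (Set.Iio (0 : ℝ)).indicator (fun t => 1 / 2 * (1 - t ^ 2 / v)) t +
    (Set.Ioi A).indicator (fun t => 1 / 2 * (1 - (t - A) ^ 2 / v)) t

/-- Normalization of the one-dimensional output density. -/
def Kc (A v : ℝ) : ℝ := A + Real.sqrt v * Real.sqrt (2 * Real.pi * Real.exp 1)

/-- One-dimensional output density. -/
def rdens (A v t : ℝ) : ℝ := (Kc A v)⁻¹ * Real.exp (pen A v t)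

lemma Kc_pos {A v : ℝ} (hA : 0 < A) : 0 < Kc A v := by
  unfold Kc; positivity

lemma rdens_pos {A v : ℝ} (hA : 0 < A) (t : ℝ) : 0 < rdens A v t := by
  unfold rdens; have := Kc_pos (v := v) hA; positivity

lemma measurable_pen (A v : ℝ) : Measurable (pen A v) := by
  unfold pen
  apply Measurable.add
  · exact Measurable.indicator (by fun_prop) measurableSet_Iio
  · exact Measurable.indicator (by fun_prop) measurableSet_Ioi

lemma measurable_rdens (A v : ℝ) : Measurable (rdens A v) := by
  unfold rdens
  exact (Real.measurable_exp.comp (measurable_pen A v)).const_mul _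

lemma pen_of_neg {A v t : ℝ} (hA : 0 < A) (ht : t < 0) : pen A v t = 1 / 2 * (1 - t ^ 2 / v) := by
  unfold pen
  rw [Set.indicator_of_mem (by exact ht), Set.indicator_of_notMem (by simp; linarith), add_zero]

lemma pen_of_mid {A v t : ℝ} (h0 : 0 ≤ t) (ht : t ≤ A) : pen A v t = 0 := by
  unfold pen
  rw [Set.indicator_of_notMem (by simpa using h0), Set.indicator_of_notMem (by simpa using ht),
    add_zero]

lemma pen_of_gt {A v t : ℝ} (hA : 0 < A) (ht : A < t) :
    pen A v t = 1 / 2 * (1 - (t - A) ^ 2 / v) := by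
  unfold pen
  rw [Set.indicator_of_notMem (by simp; linarith), Set.indicator_of_mem (by exact ht), zero_add]

lemma pen_le {A v : ℝ} (hA : 0 < A) (hv : 0 < v) (t : ℝ) : pen A v t ≤ 1 / 2 := by
  rcases lt_or_ge t 0 with h | h
  · rw [pen_of_neg hA h]; have : 0 ≤ t ^ 2 / v := by positivity
    linarith
  rcases le_or_gt t A with h' | h'
  · rw [pen_of_mid h h']; norm_num
  · rw [pen_of_gt hA h']; have : 0 ≤ (t - A) ^ 2 / v := by positivity
    linarith

lemma pen_ge {A v : ℝ} (hA : 0 < A) (hv : 0 < v) (t : ℝ) : - (t ^ 2 / v) ≤ pen A v t := by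
  have h0 : 0 ≤ t ^ 2 / v := by positivity
  rcases lt_or_ge t 0 with h | h
  · rw [pen_of_neg hA h]; linarith
  rcases le_or_gt t A with h' | h'
  · rw [pen_of_mid h h']; linarith
  · rw [pen_of_gt hA h']
    have : (t - A) ^ 2 / v ≤ t ^ 2 / v := by
      gcongr
      · linarith
    linarith

lemma log_rdens {A v : ℝ} (hA : 0 < A) (t : ℝ) :
    Real.log (rdens A v t) = - Real.log (Kc A v) + pen A v t := by
  unfold rdens
  have := Kc_pos (v := v) hA
  rw [Real.log_mul (by positivity) (by positivity), Real.log_inv, Real.log_exp]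

lemma integrable_half (v : ℝ) (hv : 0 < v) :
    Integrable (fun t : ℝ => Real.exp (- t ^ 2 / (2 * v))) := by
  have := integrable_exp_neg_mul_sq (b := 1 / (2 * v)) (by positivity)
  refine this.congr (Eventually.of_forall fun t => ?_)
  simp only; congr 1; ring

lemma integral_half (v : ℝ) (hv : 0 < v) :
    ∫ t in Set.Ioi (0 : ℝ), Real.exp (- t ^ 2 / (2 * v)) =
      Real.sqrt v * Real.sqrt (2 * Real.pi) / 2 := by
  have := integral_gaussian_Ioi (1 / (2 * v))
  rw [← Real.sqrt_mul hv.le]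
  calc _ = ∫ t in Set.Ioi (0 : ℝ), Real.exp (- (1 / (2 * v)) * t ^ 2) := by
        congr 1; ext t; congr 1; ring
    _ = _ := by rw [this]; congr 2; field_simp

lemma shift_Ioi (f : ℝ → ℝ) (c a : ℝ) :
    ∫ t in Set.Ioi c, f (t + a) = ∫ t in Set.Ioi (c + a), f t := by
  rw [← integral_indicator measurableSet_Ioi, ← integral_indicator measurableSet_Ioi,
    ← integral_add_right_eq_self ((Set.Ioi (c + a)).indicator f) a]
  congr 1; ext t
  by_cases h : c < t
  · rw [Set.indicator_of_mem (by exact h), Set.indicator_of_mem (by simpa using h)]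
  · rw [Set.indicator_of_notMem (by exact h), Set.indicator_of_notMem (by simpa using h)]

/-- Total mass of the one-dimensional density -/
lemma integrable_rdens {A v : ℝ} (hA : 0 < A) (hv : 0 < v) :
    Integrable (rdens A v) ∧ ∫ t, rdens A v t = 1 := by
  have hK := Kc_pos (v := v) hA
  set c := (Kc A v)⁻¹ with hc
  -- left part
  have e1 : ∀ t ∈ Set.Iio (0:ℝ), c * Real.exp (1/2) * Real.exp (- t ^ 2 / (2 * v)) = rdens A v t := by
    intro t ht
    rw [rdens, pen_of_neg hA ht, mul_assoc, ← Real.exp_add]; congr 2; field_simp; ring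
  have e2 : ∀ t ∈ Set.Icc (0:ℝ) A, c = rdens A v t := by
    intro t ht
    rw [rdens, pen_of_mid ht.1 ht.2]; simp [hc]
  have e3 : ∀ t ∈ Set.Ioi A,
      c * Real.exp (1/2) * Real.exp (- (t - A) ^ 2 / (2 * v)) = rdens A v t := by
    intro t ht
    rw [rdens, pen_of_gt hA ht, mul_assoc, ← Real.exp_add]; congr 2; field_simp; ring
  have i1 : IntegrableOn (rdens A v) (Set.Iio 0) := by
    refine IntegrableOn.congr_fun ?_ e1 measurableSet_Iio
    exact ((integrable_half v hv).const_mul _).integrableOn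
  have i2 : IntegrableOn (rdens A v) (Set.Icc 0 A) := by
    refine IntegrableOn.congr_fun ?_ e2 measurableSet_Icc
    exact integrableOn_const (by simp)
  have i3 : IntegrableOn (rdens A v) (Set.Ioi A) := by
    refine IntegrableOn.congr_fun ?_ e3 measurableSet_Ioi
    exact (((integrable_half v hv).comp_sub_right A).const_mul _).integrableOn
  have u1 : Set.Icc (0:ℝ) A ∪ Set.Ioi A = Set.Ici 0 := Set.Icc_union_Ioi_eq_Ici hA.le
  have u2 : Set.Iio (0:ℝ) ∪ Set.Ici 0 = Set.univ := Set.Iio_union_Ici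
  have i4 : IntegrableOn (rdens A v) (Set.Ici 0) := u1 ▸ i2.union i3
  refine ⟨by rw [← integrableOn_univ, ← u2]; exact i1.union i4, ?_⟩
  have v1 : ∫ t in Set.Iio (0:ℝ), rdens A v t = c * Real.exp (1/2) * (Real.sqrt v * Real.sqrt (2 * Real.pi) / 2) := by
    rw [← setIntegral_congr_fun measurableSet_Iio e1, integral_const_mul, ← integral_Iic_eq_integral_Iio]
    congr 1
    rw [← integral_half v hv]
    have := integral_comp_neg_Ioi (0:ℝ) (fun t => Real.exp (- t ^ 2 / (2 * v)))
    rw [neg_zero] at this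
    rw [← this]; simp
  have v3 : ∫ t in Set.Ioi A, rdens A v t = c * Real.exp (1/2) * (Real.sqrt v * Real.sqrt (2 * Real.pi) / 2) := by
    rw [← setIntegral_congr_fun measurableSet_Ioi e3, integral_const_mul]
    congr 1
    rw [← integral_half v hv]
    have := shift_Ioi (fun t => Real.exp (- (t - A) ^ 2 / (2 * v))) (0:ℝ) A
    rw [zero_add] at this
    rw [← this]; simp
  have v2 : ∫ t in Set.Icc (0:ℝ) A, rdens A v t = c * A := by
    rw [← setIntegral_congr_fun measurableSet_Icc e2, setIntegral_const]
    simp [hA.le, mul_comm]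
  rw [← setIntegral_univ, ← u2, setIntegral_union (by simp [Set.disjoint_left]) measurableSet_Ici i1 i4,
    ← u1, setIntegral_union (by rw [Set.disjoint_left]; intro x hx; simpa using hx.2) measurableSet_Ioi i2 i3, v1, v2, v3]
  have hs : Real.sqrt (2 * Real.pi * Real.exp 1) = Real.sqrt (2 * Real.pi) * Real.exp (1/2) := by
    rw [Real.sqrt_mul (by positivity), ← Real.exp_half]
  have : c * Kc A v = 1 := by rw [hc]; field_simp
  rw [Kc, hs] at this
  linarith

/-- The half-line estimate. -/
lemma half_estimate_vol (v a : ℝ) (hv : 0 < v) (ha : 0 ≤ a) :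
    IntegrableOn (fun t => Real.exp (- t ^ 2 / (2 * v)) * (1 - (t - a) ^ 2 / v)) (Set.Ioi a) ∧
    0 ≤ ∫ t in Set.Ioi a, Real.exp (- t ^ 2 / (2 * v)) * (1 - (t - a) ^ 2 / v) := by
  have hi0 := integrable_half v hv
  have hi2 : Integrable (fun t : ℝ => t ^ 2 * Real.exp (- t ^ 2 / (2 * v))) := by
    have := integrable_rpow_mul_exp_neg_mul_sq (b := 1 / (2 * v)) (by positivity) (s := 2) (by norm_num)
    refine this.congr (Eventually.of_forall fun t => ?_)
    simp only [Real.rpow_two]; congr 2; ring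
  have hi1 : Integrable (fun t : ℝ => t * Real.exp (- t ^ 2 / (2 * v))) := by
    have := integrable_mul_exp_neg_mul_sq (b := 1 / (2 * v)) (by positivity)
    refine this.congr (Eventually.of_forall fun t => ?_)
    simp only; congr 2; ring
  have hia : Integrable (fun t => Real.exp (- t ^ 2 / (2 * v)) * (1 - (t - a) ^ 2 / v)) := by
    have := ((hi0.const_mul (1 - a^2 / v)).add (hi1.const_mul (2 * a / v))).sub (hi2.const_mul (1 / v))
    refine this.congr (Eventually.of_forall fun t => ?_)
    simp only [Pi.add_apply, Pi.sub_apply]; field_simp; ring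
  refine ⟨hia.integrableOn, ?_⟩
  have hz : ∫ t in Set.Ioi (0:ℝ), Real.exp (- t ^ 2 / (2 * v)) * (1 - t ^ 2 / v) = 0 := by
    have hint : Integrable (fun t : ℝ => Real.exp (- t ^ 2 / (2 * v)) * (1 - t ^ 2 / v)) := by
      refine (hi0.sub (hi2.const_mul (1/v))).congr (Eventually.of_forall fun t => ?_)
      simp only [Pi.sub_apply]; field_simp
    have hd : ∀ t : ℝ, HasDerivAt (fun t : ℝ => t * Real.exp (- t ^ 2 / (2 * v)))
        (Real.exp (- t ^ 2 / (2 * v)) * (1 - t ^ 2 / v)) t := by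
      intro t
      have h1 : HasDerivAt (fun t : ℝ => - t ^ 2 / (2 * v)) (-(2 * t) / (2 * v)) t := by
        have := ((hasDerivAt_pow 2 t).neg).div_const (2 * v)
        simpa using this
      have := (hasDerivAt_id t).mul h1.exp
      have e : Real.exp (- t ^ 2 / (2 * v)) * (1 - t ^ 2 / v) = 1 * Real.exp (- t ^ 2 / (2 * v)) +
          t * (Real.exp (- t ^ 2 / (2 * v)) * (-(2 * t) / (2 * v))) := by
        field_simp; ring
      rw [e]; exact this
    have := integral_Ioi_of_hasDerivAt_of_tendsto' (a := (0:ℝ)) (m := 0) (fun t _ => hd t) hint.integrableOn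
      (tendsto_zero_of_hasDerivAt_of_integrableOn_Ioi (a := (0:ℝ)) (fun t _ => hd t) hint.integrableOn hi1.integrableOn)
    rw [this]; simp
  have hsh := shift_Ioi (fun t => Real.exp (- t ^ 2 / (2 * v)) * (1 - (t - a) ^ 2 / v)) (0:ℝ) a
  rw [zero_add] at hsh
  rw [← hsh]
  have hint2 := (hia.comp_add_right a).integrableOn (s := Set.Ioi (0:ℝ))
  set σ := Real.sqrt v
  have hσ : 0 < σ := Real.sqrt_pos.2 hv
  have hσ2 : σ ^ 2 = v := Real.sq_sqrt hv.le
  have hle : ∫ t in Set.Ioi (0:ℝ), Real.exp (-a^2/(2*v)) * Real.exp (-a * σ / v) * (Real.exp (- t ^ 2 / (2 * v)) * (1 - t ^ 2 / v))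
     ≤ ∫ t in Set.Ioi (0:ℝ), Real.exp (- (t + a) ^ 2 / (2 * v)) * (1 - (t + a - a) ^ 2 / v) := by
    refine setIntegral_mono_on ?_ hint2 measurableSet_Ioi ?_
    · refine Integrable.integrableOn (Integrable.const_mul ?_ _)
      refine (hi0.sub (hi2.const_mul (1/v))).congr (Eventually.of_forall fun t => ?_)
      simp only [Pi.sub_apply]; field_simp
    · intro t ht
      have ht : 0 < t := ht
      have e : Real.exp (- (t + a) ^ 2 / (2 * v)) = Real.exp (-a^2/(2*v)) * Real.exp (- t ^ 2 / (2 * v)) * Real.exp (-a * t / v) := by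
        rw [← Real.exp_add, ← Real.exp_add]; congr 1; field_simp; ring
      rw [e, add_sub_cancel_right]
      have key : Real.exp (-a * σ / v) * (1 - t ^ 2 / v) ≤ Real.exp (-a * t / v) * (1 - t ^ 2 / v) := by
        rcases le_total t σ with h | h
        · have : 0 ≤ 1 - t ^ 2 / v := by
            rw [sub_nonneg, div_le_one hv, ← hσ2]; gcongr
          apply mul_le_mul_of_nonneg_right _ this
          apply Real.exp_le_exp.2
          gcongr ?_ / v
          nlinarith
        · have : 1 - t ^ 2 / v ≤ 0 := by
            rw [sub_nonpos, one_le_div hv, ← hσ2]; gcongr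
          apply mul_le_mul_of_nonpos_right _ this
          apply Real.exp_le_exp.2
          gcongr ?_ / v
          nlinarith
      have hp : 0 ≤ Real.exp (-a^2/(2*v)) * Real.exp (- t ^ 2 / (2 * v)) := by positivity
      have := mul_le_mul_of_nonneg_left key hp
      linarith
  rw [integral_const_mul, hz, mul_zero] at hle
  exact hle

/-- Tail function used in the Gaussian estimate. -/
def tailF (v a : ℝ) : ℝ → ℝ := (Set.Ioi a).indicator (fun t => 1 - (t - a) ^ 2 / v)

lemma tailF_gauss (v : ℝ≥0) (a : ℝ) (hv : v ≠ 0) (ha : 0 ≤ a) :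
    Integrable (tailF v a) (gaussianReal 0 v) ∧ 0 ≤ ∫ t, tailF v a t ∂(gaussianReal 0 v) := by
  have hv' : (0:ℝ) < v := by positivity
  obtain ⟨h1, h2⟩ := half_estimate_vol v a hv' ha
  have e : (fun t => gaussianPDFReal 0 v t • tailF v a t) = (Set.Ioi a).indicator
      (fun t => (√(2 * Real.pi * v))⁻¹ * (Real.exp (- t ^ 2 / (2 * v)) * (1 - (t - a) ^ 2 / v))) := by
    ext t
    by_cases h : t ∈ Set.Ioi a
    · rw [tailF, Set.indicator_of_mem h, Set.indicator_of_mem h, gaussianPDFReal]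
      simp only [sub_zero, smul_eq_mul]; ring
    · rw [tailF, Set.indicator_of_notMem h, Set.indicator_of_notMem h]; simp
  constructor
  · rw [gaussianReal_of_var_ne_zero _ hv]
    rw [show gaussianPDF 0 v = fun t => ENNReal.ofReal (gaussianPDFReal 0 v t) from rfl]
    rw [integrable_withDensity_iff_integrable_smul₀' (by fun_prop) (by simp)]
    simp_rw [ENNReal.toReal_ofReal (gaussianPDFReal_nonneg _ _ _)]
    rw [e, integrable_indicator_iff measurableSet_Ioi]
    exact h1.const_mul _
  · rw [integral_gaussianReal_eq_integral_smul hv, e, integral_indicator measurableSet_Ioi,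
      integral_const_mul]
    positivity

lemma pen_gauss (A : ℝ) (v : ℝ≥0) (s : ℝ) (hv : v ≠ 0) (hs : s ∈ Set.Icc 0 A) :
    Integrable (fun g => pen A v (s + g)) (gaussianReal 0 v) ∧
      0 ≤ ∫ g, pen A v (s + g) ∂(gaussianReal 0 v) := by
  obtain ⟨a1, a2⟩ := tailF_gauss v s hv hs.1
  obtain ⟨b1, b2⟩ := tailF_gauss v (A - s) hv (by linarith [hs.2])
  have hmap : (gaussianReal 0 v).map (fun x => -x) = gaussianReal 0 v := by
    rw [gaussianReal_map_neg]; simp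
  have c1 : Integrable (fun g => tailF v s (-g)) (gaussianReal 0 v) := by
    rw [← hmap] at a1
    exact a1.comp_measurable measurable_neg
  have c2 : ∫ g, tailF v s (-g) ∂(gaussianReal 0 v) = ∫ g, tailF v s g ∂(gaussianReal 0 v) := by
    conv_rhs => rw [← hmap]
    rw [integral_map (by fun_prop)]
    rw [hmap]; exact a1.1
  have e : (fun g => pen A v (s + g)) = fun g => 1 / 2 * (tailF v s (-g) + tailF v (A - s) g) := by
    ext g
    unfold pen tailF
    rw [mul_add]
    congr 1
    · by_cases h : s + g < 0
      · rw [Set.indicator_of_mem (by exact h), Set.indicator_of_mem (by simp; linarith)]; ring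
      · rw [Set.indicator_of_notMem (by exact h), Set.indicator_of_notMem (by simp; linarith)]; ring
    · by_cases h : A < s + g
      · rw [Set.indicator_of_mem (by exact h), Set.indicator_of_mem (by simp; linarith)]; ring
      · rw [Set.indicator_of_notMem (by exact h), Set.indicator_of_notMem (by simp; linarith)]; ring
  rw [e]
  refine ⟨(c1.add b1).const_mul _, ?_⟩
  rw [integral_const_mul, integral_add c1 b1, c2]
  positivity


/-! ### Covering of the zonotope by parallelepipeds -/

lemma HU_col {H : Matrix (Fin nr) (Fin nt) ℝ} {U : Finset (Fin nt)} (hU : U.card = nr)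
    (i : Fin nr) : (HU H U)ᵀ i = Hᵀ (U.orderEmbOfFin hU i) := by
  unfold HU; rw [dif_pos hU]; rfl

lemma det_HU_ne_zero {H : Matrix (Fin nr) (Fin nt) ℝ} {U : Finset (Fin nt)}
    (hU : U ∈ goodSets H) : IsUnit (HU H U).det := by
  obtain ⟨h1, h2⟩ := hU
  rw [← Matrix.isUnit_iff_isUnit_det, ← Matrix.linearIndependent_cols_iff_isUnit]
  have := h2.comp (fun i : Fin nr => (⟨U.orderEmbOfFin h1 i, Finset.orderEmbOfFin_mem U h1 i⟩ : {x // x ∈ U}))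
    (by intro a b hab; simpa using hab)
  have e : (HU H U).col = ((fun (j : {x // x ∈ U}) i => H i j.1) ∘
      fun i : Fin nr => ⟨U.orderEmbOfFin h1 i, Finset.orderEmbOfFin_mem U h1 i⟩) := by
    funext i
    exact HU_col (H := H) h1 i
  rw [e]
  exact this

/-- Linear functional in the cost vector `c` giving the (negated) predicted cost of column `j`. -/
lemma exists_generic (H : Matrix (Fin nr) (Fin nt) ℝ) :
    ∃ c : Fin nt → ℝ, ∀ (U : Finset (Fin nt)) (hU : U.card = nr), ∀ j ∉ U,
      c j ≠ ∑ i, ((HU H U)⁻¹ *ᵥ Hᵀ j) i * c (U.orderEmbOfFin hU i) := by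
  let ι := {q : Finset (Fin nt) × Fin nt // q.1.card = nr ∧ q.2 ∉ q.1}
  let L : ι → ((Fin nt → ℝ) →ₗ[ℝ] ℝ) := fun q => LinearMap.proj q.1.2 -
    ∑ i, ((HU H q.1.1)⁻¹ *ᵥ Hᵀ q.1.2) i • LinearMap.proj (q.1.1.orderEmbOfFin q.2.1 i)
  have hL : ∀ q c, L q c = c q.1.2 - ∑ i, ((HU H q.1.1)⁻¹ *ᵥ Hᵀ q.1.2) i * c (q.1.1.orderEmbOfFin q.2.1 i) := by
    intro q c; simp [L]
  by_contra hcon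
  push Not at hcon
  have hcov : ⋃ q, ((LinearMap.ker (L q) : Submodule ℝ (Fin nt → ℝ)) : Set (Fin nt → ℝ)) = Set.univ := by
    rw [Set.eq_univ_iff_forall]
    intro c
    obtain ⟨U, hU, j, hj, h⟩ := hcon c
    rw [Set.mem_iUnion]
    refine ⟨⟨(U, j), hU, hj⟩, ?_⟩
    simp only [SetLike.mem_coe, LinearMap.mem_ker, hL]
    rw [h, sub_self]
  obtain ⟨q, hq⟩ := Subspace.exists_eq_top_of_iUnion_eq_univ hcov
  have h1 : L q (Pi.single q.1.2 1) = 0 := by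
    rw [← LinearMap.mem_ker, hq]; trivial
  rw [hL, Finset.sum_eq_zero] at h1
  · simp at h1
  · intro i _
    rw [Pi.single_eq_of_ne, mul_zero]
    intro he
    exact q.2.2 (he ▸ Finset.orderEmbOfFin_mem q.1.1 q.2.1 i)

lemma span_cols {H : Matrix (Fin nr) (Fin nt) ℝ} (hrank : H.rank = nr) :
    Submodule.span ℝ (Set.range Hᵀ) = ⊤ := by
  apply Submodule.eq_top_of_finrank_eq
  rw [Matrix.rank_eq_finrank_span_cols] at hrank
  rw [Module.finrank_fin_fun]
  exact hrank

/-- Moving the dual vector until the tight columns span. -/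
lemma exists_dual {H : Matrix (Fin nr) (Fin nt) ℝ} (hrank : H.rank = nr) (c : Fin nt → ℝ)
    (u : Fin nr → ℝ) : ∃ u' : Fin nr → ℝ,
      (∀ j, (0 < c j - u' ⬝ᵥ Hᵀ j → 0 < c j - u ⬝ᵥ Hᵀ j) ∧
        (c j - u' ⬝ᵥ Hᵀ j < 0 → c j - u ⬝ᵥ Hᵀ j < 0)) ∧
      Submodule.span ℝ (Set.range (fun j : {j // c j - u' ⬝ᵥ Hᵀ j = 0} => Hᵀ j.1)) = ⊤ := by
  classical
  let P : (Fin nr → ℝ) → Prop := fun u' => ∀ j, (0 < c j - u' ⬝ᵥ Hᵀ j → 0 < c j - u ⬝ᵥ Hᵀ j) ∧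
        (c j - u' ⬝ᵥ Hᵀ j < 0 → c j - u ⬝ᵥ Hᵀ j < 0)
  let m : (Fin nr → ℝ) → ℕ := fun u' => (Finset.univ.filter fun j => c j - u' ⬝ᵥ Hᵀ j ≠ 0).card
  have hex : ∃ k, ∃ u', P u' ∧ m u' = k := ⟨m u, u, fun j => ⟨id, id⟩, rfl⟩
  obtain ⟨u', hP, hm⟩ := Nat.find_spec hex
  have hmin : ∀ w, P w → m u' ≤ m w := fun w hw => hm ▸ Nat.find_min' hex ⟨w, hw, rfl⟩
  refine ⟨u', hP, ?_⟩
  by_contra hspan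
  obtain ⟨f, hf0, hf⟩ := Submodule.exists_dual_map_eq_bot_of_lt_top (lt_top_iff_ne_top.2 hspan) inferInstance
  -- represent `f` as a dot product
  set d : Fin nr → ℝ := fun i => f (Pi.single i 1) with hd
  have hfd : ∀ x, f x = d ⬝ᵥ x := by
    intro x
    conv_lhs => rw [← Finset.univ_sum_single x]
    rw [map_sum, dotProduct]
    refine Finset.sum_congr rfl fun i _ => ?_
    have : Pi.single i (x i) = x i • (Pi.single i 1 : Fin nr → ℝ) := by
      rw [← Pi.single_smul, smul_eq_mul, mul_one]
    rw [this, map_smul, smul_eq_mul, mul_comm]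
  have htight : ∀ j, c j - u' ⬝ᵥ Hᵀ j = 0 → d ⬝ᵥ Hᵀ j = 0 := by
    intro j hj
    rw [← hfd]
    have : f (Hᵀ j) ∈ Submodule.map f (Submodule.span ℝ (Set.range (fun j : {j // c j - u' ⬝ᵥ Hᵀ j = 0} => Hᵀ j.1))) :=
      Submodule.mem_map_of_mem (Submodule.subset_span ⟨⟨j, hj⟩, rfl⟩)
    rw [hf] at this
    simpa using this
  have hne : ∃ j, d ⬝ᵥ Hᵀ j ≠ 0 := by
    by_contra hall
    push Not at hall
    apply hf0
    have : LinearMap.ker f = ⊤ := by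
      rw [eq_top_iff, ← span_cols hrank, Submodule.span_le]
      rintro _ ⟨j, rfl⟩
      simp only [SetLike.mem_coe, LinearMap.mem_ker]
      rw [hfd]; exact hall j
    exact LinearMap.ker_eq_top.1 this
  obtain ⟨k, hk, hkmin⟩ := Finset.exists_min_image (Finset.univ.filter fun j => d ⬝ᵥ Hᵀ j ≠ 0)
    (fun j => |(c j - u' ⬝ᵥ Hᵀ j) / (d ⬝ᵥ Hᵀ j)|) (by
      obtain ⟨j, hj⟩ := hne; exact ⟨j, by simpa using hj⟩)
  have hk : d ⬝ᵥ Hᵀ k ≠ 0 := by simpa using hk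
  set t := (c k - u' ⬝ᵥ Hᵀ k) / (d ⬝ᵥ Hᵀ k) with ht
  have hr : ∀ j, c j - (u' + t • d) ⬝ᵥ Hᵀ j = (c j - u' ⬝ᵥ Hᵀ j) - t * (d ⬝ᵥ Hᵀ j) := by
    intro j; rw [add_dotProduct, smul_dotProduct, smul_eq_mul]; ring
  have habs : ∀ j, |t * (d ⬝ᵥ Hᵀ j)| ≤ |c j - u' ⬝ᵥ Hᵀ j| := by
    intro j
    by_cases hj : d ⬝ᵥ Hᵀ j = 0
    · rw [hj]; simp
    · have := (hkmin j (by simpa using hj)).trans_eq (abs_div _ _)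
      rw [le_div_iff₀ (abs_pos.2 hj)] at this
      rw [abs_mul]; exact this
  have hrk : c k - (u' + t • d) ⬝ᵥ Hᵀ k = 0 := by
    rw [hr, ht]; field_simp; ring
  have hlt : m (u' + t • d) < m u' := by
    apply Finset.card_lt_card
    rw [Finset.ssubset_iff_of_subset]
    · refine ⟨k, ?_, ?_⟩
      · simp only [Finset.mem_filter, Finset.mem_univ, true_and]
        intro h; exact hk (htight k h)
      · simp only [Finset.mem_filter, Finset.mem_univ, true_and, not_not]; exact hrk
    · intro j
      simp only [Finset.mem_filter, Finset.mem_univ, true_and]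
      intro h h'
      apply h; rw [hr, h', htight j h']; simp
  refine absurd (hmin (u' + t • d) ?_) (not_le.2 hlt)
  intro j
  have h1 := habs j
  refine ⟨fun h => (hP j).1 ?_, fun h => (hP j).2 ?_⟩
  · rw [hr] at h
    by_contra hneg
    push Not at hneg
    rw [abs_of_nonpos hneg] at h1
    linarith [(abs_le.1 h1).1]
  · rw [hr] at h
    by_contra hneg
    push Not at hneg
    rw [abs_of_nonneg hneg] at h1
    linarith [(abs_le.1 h1).2]

lemma exists_basis_subset {H : Matrix (Fin nr) (Fin nt) ℝ} (T : Fin nt → Prop)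
    (hT : Submodule.span ℝ (Set.range (fun j : {j // T j} => Hᵀ j.1)) = ⊤) :
    ∃ U ∈ goodSets H, ∀ j ∈ U, T j := by
  classical
  obtain ⟨κ, a, ha, hspan, hli⟩ := exists_linearIndependent' ℝ (fun j : {j // T j} => Hᵀ j.1)
  have : Finite κ := Finite.of_injective a ha
  have := Fintype.ofFinite κ
  rw [hT] at hspan
  let b := Module.Basis.mk hli hspan.ge
  have hcard : Fintype.card κ = nr := by
    have := Module.finrank_eq_card_basis b
    simpa using this.symm
  let g : κ → Fin nt := fun k => (a k).1
  have hg : Function.Injective g := Subtype.val_injective.comp ha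
  refine ⟨Finset.univ.image g, ⟨?_, ?_⟩, ?_⟩
  · rw [Finset.card_image_of_injective _ hg, Finset.card_univ, hcard]
  · have e : Function.Bijective (fun k : κ => (⟨g k, Finset.mem_image_of_mem g (Finset.mem_univ k)⟩ : {x // x ∈ Finset.univ.image g})) := by
      constructor
      · intro x y hxy; exact hg (by simpa using hxy)
      · rintro ⟨x, hx⟩
        obtain ⟨k, -, rfl⟩ := Finset.mem_image.1 hx
        exact ⟨k, rfl⟩
    rw [← linearIndependent_equiv (Equiv.ofBijective _ e)]
    exact hli
  · intro j hj
    obtain ⟨k, -, rfl⟩ := Finset.mem_image.1 hj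
    exact (a k).2

lemma goodSets_nonempty {H : Matrix (Fin nr) (Fin nt) ℝ} (hrank : H.rank = nr) :
    (goodSets H).Nonempty := by
  obtain ⟨u', -, h⟩ := exists_dual hrank 0 0
  obtain ⟨U, hU, -⟩ := exists_basis_subset _ h
  exact ⟨U, hU⟩

lemma kkt_aux {R N τ : ℝ} (hN : 0 ≤ N) (hτ : 0 < τ)
    (h : ∀ t, 0 < t → t ≤ τ → R ≤ t * N / 2) : R ≤ 0 := by
  by_contra hR
  push Not at hR
  have h1 := h (min τ (R / (N + 1))) (by positivity) (min_le_left _ _)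
  have h2 : min τ (R / (N + 1)) * N ≤ R / (N + 1) * N := by gcongr; exact min_le_right _ _
  have h3 : R / (N + 1) * N ≤ R := by
    rw [div_mul_eq_mul_div, div_le_iff₀ (by positivity)]; nlinarith
  linarith

/-- Approximate LP solution together with a dual certificate. -/
lemma exists_penalized (H : Matrix (Fin nr) (Fin nt) ℝ) (c : Fin nt → ℝ) {A : ℝ} (hA : 0 < A)
    (x : Fin nt → ℝ) (hx : ∀ k, x k ∈ Set.Icc 0 A) (δ : ℝ) (hδ : 0 < δ) :
    ∃ l : Fin nt → ℝ, (∀ k, l k ∈ Set.Icc 0 A) ∧ dist (H *ᵥ x) (H *ᵥ l) < δ ∧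
      ∃ u : Fin nr → ℝ, ∀ j, (0 < c j - u ⬝ᵥ Hᵀ j → l j = 0) ∧
        (c j - u ⬝ᵥ Hᵀ j < 0 → l j = A) := by
  set B := ∑ j, |c j| * A with hB
  have hB0 : 0 ≤ B := Finset.sum_nonneg fun j _ => by positivity
  set ε := δ ^ 2 / (2 * (B + 1)) with hε
  have hε0 : 0 < ε := by positivity
  let f : (Fin nt → ℝ) → ℝ := fun l => ε * (c ⬝ᵥ l) +
    1 / 2 * ((H *ᵥ l - H *ᵥ x) ⬝ᵥ (H *ᵥ l - H *ᵥ x))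
  have hcont : Continuous f := by
    unfold f dotProduct mulVec dotProduct
    fun_prop
  have hcpt : IsCompact (Set.univ.pi fun _ : Fin nt => Set.Icc (0:ℝ) A) :=
    isCompact_univ_pi fun _ => isCompact_Icc
  obtain ⟨l, hl, hmin⟩ := hcpt.exists_isMinOn ⟨x, fun k _ => hx k⟩ hcont.continuousOn
  have hl : ∀ k, l k ∈ Set.Icc 0 A := fun k => hl k trivial
  have hmin : ∀ l', (∀ k, l' k ∈ Set.Icc 0 A) → f l ≤ f l' := fun l' h => hmin (fun k _ => h k)
  set w := H *ᵥ l - H *ᵥ x with hw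
  have hww : w ⬝ᵥ w < δ ^ 2 := by
    have h1 := hmin x hx
    have h2 : f x = ε * (c ⬝ᵥ x) := by simp [f]
    have h3 : f l = ε * (c ⬝ᵥ l) + 1 / 2 * (w ⬝ᵥ w) := rfl
    have h4 : c ⬝ᵥ x - c ⬝ᵥ l ≤ B := by
      rw [← dotProduct_sub, dotProduct, hB]
      refine Finset.sum_le_sum fun j _ => ?_
      refine (le_abs_self _).trans ?_
      rw [abs_mul, Pi.sub_apply]
      gcongr
      rw [abs_le]
      constructor <;> linarith [(hx j).1, (hx j).2, (hl j).1, (hl j).2]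
    have h5 : ε * (2 * (B + 1)) = δ ^ 2 := by rw [hε]; field_simp
    have h6 := mul_le_mul_of_nonneg_left h4 hε0.le
    nlinarith
  have hstep : ∀ j s, f (l + s • Pi.single j 1) = f l + s * (ε * c j + w ⬝ᵥ Hᵀ j) +
      s ^ 2 * (Hᵀ j ⬝ᵥ Hᵀ j) / 2 := by
    intro j s
    have e1 : H *ᵥ (l + s • Pi.single j 1) - H *ᵥ x = w + s • Hᵀ j := by
      rw [mulVec_add, mulVec_smul, mulVec_single_one, hw]
      simp only [Matrix.col]
      abel
    simp only [f]
    rw [e1, ← hw]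
    simp only [dotProduct_add, add_dotProduct, smul_dotProduct, dotProduct_smul, smul_eq_mul,
      dotProduct_single_one]
    rw [dotProduct_comm (Hᵀ j) w]
    ring
  have hNN : ∀ j, 0 ≤ Hᵀ j ⬝ᵥ Hᵀ j := fun j => Finset.sum_nonneg fun i _ => mul_self_nonneg _
  have hmem : ∀ j s, l j + s ∈ Set.Icc 0 A →
      ∀ k, (l + s • (Pi.single j 1 : Fin nt → ℝ)) k ∈ Set.Icc 0 A := by
    intro j s h k
    by_cases hk : k = j
    · subst hk; simpa using h
    · simpa [hk] using hl k
  refine ⟨l, hl, ?_, (-ε⁻¹) • w, fun j => ?_⟩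
  · rw [dist_comm, dist_pi_lt_iff hδ]
    intro i
    rw [Real.dist_eq]
    have h1 : w i * w i ≤ w ⬝ᵥ w :=
      Finset.single_le_sum (f := fun i => w i * w i) (fun i _ => mul_self_nonneg _) (Finset.mem_univ i)
    have : |w i| < δ := by
      apply abs_lt_of_sq_lt_sq _ hδ.le
      nlinarith
    exact this
  · have hrw : c j - (-ε⁻¹ • w) ⬝ᵥ Hᵀ j = ε⁻¹ * (ε * c j + w ⬝ᵥ Hᵀ j) := by
      rw [smul_dotProduct, smul_eq_mul]; field_simp; ring
    rw [hrw]
    constructor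
    · intro h
      have h := (pos_iff_pos_of_mul_pos h).1 (by positivity)
      by_contra hne
      have hpos : 0 < l j := lt_of_le_of_ne (hl j).1 (Ne.symm hne)
      refine absurd (kkt_aux (hNN j) hpos fun t ht htl => ?_) (not_le.2 h)
      have h1 := hmin _ (hmem j (-t) ⟨by linarith, by linarith [(hl j).2]⟩)
      rw [hstep] at h1
      have h2 : t * (ε * c j + w ⬝ᵥ Hᵀ j) ≤ t * (t * (Hᵀ j ⬝ᵥ Hᵀ j) / 2) := by nlinarith
      exact le_of_mul_le_mul_left h2 ht
    · intro h
      have h : ε * c j + w ⬝ᵥ Hᵀ j < 0 := by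
        by_contra hh; push Not at hh
        have : 0 ≤ ε⁻¹ * (ε * c j + w ⬝ᵥ Hᵀ j) := by positivity
        linarith
      by_contra hne
      have hpos : 0 < A - l j := sub_pos.2 (lt_of_le_of_ne (hl j).2 hne)
      refine absurd (kkt_aux (R := -(ε * c j + w ⬝ᵥ Hᵀ j)) (hNN j) hpos fun t ht htl => ?_)
        (not_le.2 (by linarith))
      have h1 := hmin _ (hmem j t ⟨by linarith [(hl j).1], by linarith⟩)
      rw [hstep] at h1
      have h2 : t * -(ε * c j + w ⬝ᵥ Hᵀ j) ≤ t * (t * (Hᵀ j ⬝ᵥ Hᵀ j) / 2) := by nlinarith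
      exact le_of_mul_le_mul_left h2 ht

lemma exists_cover {H : Matrix (Fin nr) (Fin nt) ℝ} (hrank : H.rank = nr) {A : ℝ} (hA : 0 < A) :
    ∃ v : Finset (Fin nt) → (Fin nr → ℝ), ∀ x : Fin nt → ℝ, (∀ k, x k ∈ Set.Icc 0 A) →
      ∃ U ∈ goodSets H, ∃ s : Fin nr → ℝ, (∀ i, s i ∈ Set.Icc 0 A) ∧
        H *ᵥ x = v U + (HU H U) *ᵥ s := by
  classical
  obtain ⟨c, hc⟩ := exists_generic H
  let v : Finset (Fin nt) → (Fin nr → ℝ) := fun U =>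
    if hU : U.card = nr then ∑ j ∈ Uᶜ,
      if c j < ∑ i, ((HU H U)⁻¹ *ᵥ Hᵀ j) i * c (U.orderEmbOfFin hU i) then A • Hᵀ j else 0
    else 0
  let box : Set (Fin nr → ℝ) := Set.univ.pi fun _ => Set.Icc 0 A
  let C : Finset (Fin nt) → Set (Fin nr → ℝ) := fun U => (fun s => v U + (HU H U) *ᵥ s) '' box
  have hclosed : IsClosed (⋃ U ∈ goodSets H, C U) := by
    refine Set.Finite.isClosed_biUnion (Set.toFinite _) fun U _ => ?_
    refine IsCompact.isClosed ?_
    refine (isCompact_univ_pi fun _ => isCompact_Icc).image ?_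
    unfold mulVec dotProduct; fun_prop
  refine ⟨v, fun x hx => ?_⟩
  suffices h : H *ᵥ x ∈ ⋃ U ∈ goodSets H, C U by
    simp only [Set.mem_iUnion] at h
    obtain ⟨U, hU, s, hs, h⟩ := h
    exact ⟨U, hU, s, fun i => hs i trivial, h.symm⟩
  rw [← hclosed.closure_eq, Metric.mem_closure_iff]
  intro δ hδ
  obtain ⟨l, hl, hdist, u, hu⟩ := exists_penalized H c hA x hx δ hδ
  refine ⟨H *ᵥ l, ?_, hdist⟩
  obtain ⟨u', hu', hspan⟩ := exists_dual hrank c u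
  obtain ⟨U, hU, hUT⟩ := exists_basis_subset _ hspan
  have hcard : U.card = nr := hU.1
  simp only [Set.mem_iUnion]
  refine ⟨U, hU, fun i => l (U.orderEmbOfFin hcard i), fun i _ => hl _, ?_⟩
  have hpred : ∀ j, ∑ i, ((HU H U)⁻¹ *ᵥ Hᵀ j) i * c (U.orderEmbOfFin hcard i) = u' ⬝ᵥ Hᵀ j := by
    intro j
    have h1 : (HU H U) *ᵥ ((HU H U)⁻¹ *ᵥ Hᵀ j) = Hᵀ j := by
      rw [mulVec_mulVec, Matrix.mul_nonsing_inv _ (det_HU_ne_zero hU), one_mulVec]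
    conv_rhs => rw [← h1, dotProduct_mulVec, dotProduct_comm]
    refine Finset.sum_congr rfl fun i _ => ?_
    congr 1
    have h2 := hUT _ (Finset.orderEmbOfFin_mem U hcard i)
    rw [← HU_col hcard i] at h2
    exact sub_eq_zero.1 h2
  have hsplit : H *ᵥ l = ∑ j, l j • Hᵀ j := by
    ext r; simp [mulVec, dotProduct, Finset.sum_apply, mul_comm]
  have hsplit2 : (HU H U) *ᵥ (fun i => l (U.orderEmbOfFin hcard i)) = ∑ j ∈ U, l j • Hᵀ j := by
    have : ∑ j ∈ U, l j • Hᵀ j = ∑ i, l (U.orderEmbOfFin hcard i) • Hᵀ (U.orderEmbOfFin hcard i) := by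
      conv_lhs => rw [← Finset.image_orderEmbOfFin_univ U hcard]
      rw [Finset.sum_image (fun a _ b _ h => (U.orderEmbOfFin hcard).injective h)]
    rw [this]
    simp_rw [← HU_col hcard]
    ext r; simp [mulVec, dotProduct, Finset.sum_apply, mul_comm]
  show v U + (HU H U) *ᵥ (fun i => l (U.orderEmbOfFin hcard i)) = H *ᵥ l
  rw [hsplit, hsplit2, ← Finset.sum_compl_add_sum U]
  congr 1
  simp only [v, dif_pos hcard]
  refine Finset.sum_congr rfl fun j hj => ?_
  have hj : j ∉ U := by simpa using hj
  have hne := hc U hcard j hj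
  rw [hpred] at hne ⊢
  rcases lt_or_gt_of_ne hne with h | h
  · rw [if_pos h, (hu j).2 ((hu' j).2 (by linarith))]
  · rw [if_neg (by linarith), (hu j).1 ((hu' j).1 (by linarith)), zero_smul]


/-! ### Gaussian vectors -/

/-- Density of the standard Gaussian vector. -/
def gd (z : Fin nr → ℝ) : ℝ := ∏ i, gaussianPDFReal 0 1 (z i)

lemma gd_pos (z : Fin nr → ℝ) : 0 < gd z :=
  Finset.prod_pos fun i _ => gaussianPDFReal_pos _ _ _ one_ne_zero

lemma measurable_gd : Measurable (gd : (Fin nr → ℝ) → ℝ) := by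
  unfold gd
  exact Finset.measurable_prod _ fun i _ =>
    (measurable_gaussianPDFReal 0 1).comp (measurable_pi_apply i)

lemma gaussianPDFReal_le_one (t : ℝ) : gaussianPDFReal 0 1 t ≤ 1 := by
  rw [gaussianPDFReal]
  have h1 : (√(2 * Real.pi * ((1 : ℝ≥0) : ℝ)))⁻¹ ≤ 1 := by
    apply inv_le_one_of_one_le₀
    rw [Real.one_le_sqrt]
    have := Real.pi_gt_three
    simp only [NNReal.coe_one]; linarith
  have h2 : Real.exp (-(t - 0) ^ 2 / (2 * ((1 : ℝ≥0) : ℝ))) ≤ 1 := by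
    rw [Real.exp_le_one_iff]
    simp only [NNReal.coe_one]
    have := sq_nonneg (t - 0)
    linarith
  calc _ ≤ (1:ℝ) * 1 := by gcongr
    _ = 1 := one_mul 1

lemma gd_le_one (z : Fin nr → ℝ) : gd z ≤ 1 :=
  Finset.prod_le_one (fun i _ => gaussianPDFReal_nonneg _ _ _) fun i _ => gaussianPDFReal_le_one _

instance instProbStd (n : ℕ) : IsProbabilityMeasure (stdGaussian n) := by
  unfold stdGaussian; infer_instance

lemma stdGaussian_eq_withDensity :
    stdGaussian nr = (volume : Measure (Fin nr → ℝ)).withDensity (fun z => ENNReal.ofReal (gd z)) := by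
  unfold stdGaussian
  refine Measure.pi_eq fun s hs => ?_
  rw [withDensity_apply _ (MeasurableSet.univ_pi hs), ← lintegral_indicator (MeasurableSet.univ_pi hs)]
  let f : Fin nr → ℝ → ℝ := fun i => (s i).indicator (gaussianPDFReal 0 1)
  have hf0 : ∀ i t, 0 ≤ f i t := fun i t => Set.indicator_nonneg (fun t _ => gaussianPDFReal_nonneg _ _ _) t
  have hfi : ∀ i, Integrable (f i) := fun i => (integrable_gaussianPDFReal 0 1).indicator (hs i)
  have e : ∀ z : Fin nr → ℝ, (Set.univ.pi s).indicator (fun z => ENNReal.ofReal (gd z)) z =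
      ENNReal.ofReal (∏ i, f i (z i)) := by
    intro z
    by_cases hz : z ∈ Set.univ.pi s
    · rw [Set.indicator_of_mem hz]
      congr 1
      refine Finset.prod_congr rfl fun i _ => ?_
      show _ = (s i).indicator (gaussianPDFReal 0 1) (z i)
      rw [Set.indicator_of_mem (hz i trivial)]
    · rw [Set.indicator_of_notMem hz]
      have : ∃ i, z i ∉ s i := by
        by_contra hcon; push Not at hcon; exact hz fun i _ => hcon i
      obtain ⟨i, hi⟩ := this
      rw [Finset.prod_eq_zero (Finset.mem_univ i) (Set.indicator_of_notMem hi _), ENNReal.ofReal_zero]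
  simp_rw [e]
  have hi : Integrable (fun z : Fin nr → ℝ => ∏ i, f i (z i)) volume := Integrable.fintype_prod hfi
  rw [← ofReal_integral_eq_lintegral_ofReal hi
    (Eventually.of_forall fun z => Finset.prod_nonneg fun i _ => hf0 i _),
    integral_fintype_prod_volume_eq_prod, ENNReal.ofReal_prod_of_nonneg
    (fun i _ => integral_nonneg (hf0 i))]
  refine Finset.prod_congr rfl fun i _ => ?_
  rw [gaussianReal_apply_eq_integral _ one_ne_zero, integral_indicator (hs i)]

lemma stdGaussian_map_dot (a : Fin nr → ℝ) (v : ℝ≥0) (hv : (v : ℝ) = a ⬝ᵥ a) :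
    (stdGaussian nr).map (fun z => a ⬝ᵥ z) = gaussianReal 0 v := by
  have h1 := ProbabilityTheory.map_pi_eq_stdGaussian (ι := Fin nr)
  let L : StrongDual ℝ (EuclideanSpace ℝ (Fin nr)) := innerSL ℝ (WithLp.toLp 2 a)
  have hL : (fun z : Fin nr → ℝ => a ⬝ᵥ z) = L ∘ (WithLp.toLp 2) := by
    ext z
    simp [L, PiLp.inner_apply, dotProduct, mul_comm]
  rw [hL, ← Measure.map_map (by fun_prop) (by fun_prop)]
  unfold stdGaussian
  rw [h1, IsGaussian.map_eq_gaussianReal, integral_strongDual_stdGaussian, variance_dual_stdGaussian]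
  congr 1
  have : ‖L‖ ^ 2 = v := by
    rw [innerSL_apply_norm, EuclideanSpace.real_norm_sq_eq, hv]
    simp [dotProduct, sq]
  rw [this, Real.toNNReal_coe]

lemma memLp_coord (i : Fin nr) : MemLp (fun z : Fin nr → ℝ => z i) 2 (stdGaussian nr) := by
  have h : MeasurePreserving (fun z : Fin nr → ℝ => z i) (stdGaussian nr) (gaussianReal 0 1) :=
    measurePreserving_eval (fun _ => gaussianReal 0 1) i
  exact (memLp_id_gaussianReal 2).comp_measurePreserving h

lemma integral_coord_sq (i : Fin nr) : ∫ z, (z i) ^ 2 ∂(stdGaussian nr) = 1 := by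
  have h : MeasurePreserving (fun z : Fin nr → ℝ => z i) (stdGaussian nr) (gaussianReal 0 1) :=
    measurePreserving_eval (fun _ => gaussianReal 0 1) i
  have h1 : ∫ z, (z i) ^ 2 ∂(stdGaussian nr) = ∫ t, t ^ 2 ∂(gaussianReal 0 1) := by
    rw [← h.map_eq, integral_map h.measurable.aemeasurable (by fun_prop)]
  rw [h1]
  have h2 := variance_eq_integral (μ := gaussianReal 0 1) (X := id) (by fun_prop)
  rw [variance_id_gaussianReal] at h2
  simp at h2
  exact h2.symm

lemma log_gd (z : Fin nr → ℝ) : Real.log (gd z) =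
    ∑ i : Fin nr, (- Real.log (Real.sqrt (2 * Real.pi)) - 1 / 2 * (z i) ^ 2) := by
  unfold gd
  rw [Real.log_prod (fun i _ => (gaussianPDFReal_pos _ _ _ one_ne_zero).ne')]
  refine Finset.sum_congr rfl fun i _ => ?_
  rw [gaussianPDFReal, Real.log_mul (by positivity) (by positivity), Real.log_exp, Real.log_inv]
  simp only [NNReal.coe_one, mul_one, sub_zero]; ring

lemma integrable_log_gd : Integrable (fun z : Fin nr → ℝ => Real.log (gd z)) (stdGaussian nr) := by
  simp_rw [log_gd]
  exact integrable_finsetSum _ fun i _ =>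
    (integrable_const _).sub ((memLp_coord i).integrable_sq.const_mul _)

lemma integral_log_gd : ∫ z : Fin nr → ℝ, Real.log (gd z) ∂(stdGaussian nr) =
    - (nr * Real.log (Real.sqrt (2 * Real.pi * Real.exp 1))) := by
  simp_rw [log_gd]
  have hI : ∀ i : Fin nr, Integrable (fun z : Fin nr → ℝ =>
      - Real.log (Real.sqrt (2 * Real.pi)) - 1 / 2 * (z i) ^ 2) (stdGaussian nr) := fun i =>
    (integrable_const _).sub ((memLp_coord i).integrable_sq.const_mul _)
  rw [integral_finsetSum _ fun i _ => hI i]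
  have : ∀ i : Fin nr, ∫ z : Fin nr → ℝ, (- Real.log (Real.sqrt (2 * Real.pi)) - 1 / 2 * (z i) ^ 2)
      ∂(stdGaussian nr) = - Real.log (Real.sqrt (2 * Real.pi * Real.exp 1)) := by
    intro i
    rw [integral_sub (integrable_const _) ((memLp_coord i).integrable_sq.const_mul _),
      integral_const_mul, integral_coord_sq]
    rw [Real.sqrt_mul (x := 2 * Real.pi) (by positivity), ← Real.exp_half, Real.log_mul (by positivity) (by positivity), Real.log_exp]
    simp; ring
  simp_rw [this]
  simp

/-! ### Information-theoretic upper bound through an auxiliary output density -/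

lemma lintegral_to_real {Ω : Type*} [MeasurableSpace Ω] {P : Measure Ω} {f : Ω → ℝ}
    (hf : Measurable f) (h0 : ∀ ω, 0 ≤ f ω) (h : ∫⁻ ω, ENNReal.ofReal (f ω) ∂P ≤ 1) :
    Integrable f P ∧ ∫ ω, f ω ∂P ≤ 1 := by
  constructor
  · refine ⟨hf.aestronglyMeasurable, ?_⟩
    rw [hasFiniteIntegral_iff_ofReal (Eventually.of_forall h0)]
    exact h.trans_lt ENNReal.one_lt_top
  · rw [integral_eq_lintegral_of_nonneg_ae (Eventually.of_forall h0) hf.aestronglyMeasurable]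
    exact ENNReal.toReal_le_of_le_ofReal zero_le_one (by simpa using h)

lemma mutualInfo_le (H : Matrix (Fin nr) (Fin nt) ℝ) (μ : Measure (Fin nt → ℝ))
    [IsProbabilityMeasure μ] (R : (Fin nr → ℝ) → ℝ) (hR : Measurable R) (hR0 : ∀ y, 0 < R y)
    (hR1 : ∫⁻ y, ENNReal.ofReal (R y) ≤ 1) (B : ℝ)
    (hint : Integrable (fun q : (Fin nt → ℝ) × (Fin nr → ℝ) =>
      Real.log (gd q.2) - Real.log (R (H *ᵥ q.1 + q.2))) (μ.prod (stdGaussian nr)))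
    (hB : ∀ᵐ x ∂μ, ∫ z, (Real.log (gd z) - Real.log (R (H *ᵥ x + z))) ∂(stdGaussian nr) ≤ B) :
    mutualInfoJoint (jointLaw H μ) ≤ B := by
  have hHm : Measurable (fun x : Fin nt → ℝ => H *ᵥ x) := by
    apply Continuous.measurable; unfold mulVec dotProduct; fun_prop
  set m : Measure ((Fin nt → ℝ) × (Fin nr → ℝ)) := μ.prod volume with hm
  set T : (Fin nt → ℝ) × (Fin nr → ℝ) → (Fin nt → ℝ) × (Fin nr → ℝ) :=
    fun p => (p.1, H.mulVec p.1 + p.2) with hT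
  have hTm : Measurable T := measurable_fst.prodMk ((hHm.comp measurable_fst).add measurable_snd)
  set wr : (Fin nt → ℝ) × (Fin nr → ℝ) → ℝ := fun p => gd (p.2 - H *ᵥ p.1) with hwr
  have hwrm : Measurable wr := measurable_gd.comp (measurable_snd.sub (hHm.comp measurable_fst))
  set w : (Fin nt → ℝ) × (Fin nr → ℝ) → ℝ≥0∞ := fun p => ENNReal.ofReal (wr p) with hw
  have hwm : Measurable w := hwrm.ennreal_ofReal
  have hw0 : ∀ p, w p ≠ 0 := fun p => by
    simp only [hw, ne_eq, ENNReal.ofReal_eq_zero, not_le]; exact gd_pos _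
  have hwt : ∀ p, w p ≠ ∞ := fun p => ENNReal.ofReal_ne_top
  have hTmp : MeasurePreserving T m m := by
    refine (MeasurePreserving.id μ).skew_product (g := fun x z => H *ᵥ x + z) hTm.snd ?_
    exact Eventually.of_forall fun x => (measurePreserving_add_left volume (H *ᵥ x)).map_eq
  have hπT : jointLaw H μ = (μ.prod (stdGaussian nr)).map T := rfl
  have hπ : jointLaw H μ = m.withDensity w := by
    rw [hπT, stdGaussian_eq_withDensity, prod_withDensity_right measurable_gd.ennreal_ofReal]
    ext s hs
    rw [Measure.map_apply hTm hs, withDensity_apply _ (hTm hs), withDensity_apply _ hs]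
    conv_rhs => rw [← hTmp.map_eq, setLIntegral_map hs hwm hTm]
    refine lintegral_congr fun q => ?_
    simp [hw, hwr, hT]
  set π := jointLaw H μ with hπdef
  have hπprob : IsProbabilityMeasure π := by
    rw [hπT]; exact Measure.isProbabilityMeasure_map hTm.aemeasurable
  have hfst : π.map Prod.fst = μ := by
    rw [hπT, Measure.map_map measurable_fst hTm]
    have : (Prod.fst ∘ T) = Prod.fst := rfl
    rw [this, Measure.map_fst_prod]; simp
  set p : (Fin nr → ℝ) → ℝ≥0∞ := fun y => ∫⁻ x, w (x, y) ∂μ with hp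
  have hpm : Measurable p := Measurable.lintegral_prod_left' hwm
  have hp0 : ∀ y, p y ≠ 0 := by
    intro y
    rw [hp]
    simp only [ne_eq]
    have hwy : Measurable (fun x => w (x, y)) := hwm.comp (measurable_id.prodMk measurable_const)
    rw [lintegral_eq_zero_iff hwy]
    intro h
    have h' : ∀ᵐ x ∂μ, False := by
      filter_upwards [h] with x hx
      exact hw0 _ hx
    simp at h'
    exact IsProbabilityMeasure.ne_zero μ h'
  have hpt : ∀ y, p y ≠ ∞ := by
    intro y
    have : p y ≤ 1 := by
      calc p y ≤ ∫⁻ x, 1 ∂μ := lintegral_mono fun x => by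
            simp only [hw, hwr]; rw [ENNReal.ofReal_le_one]; exact gd_le_one _
        _ = 1 := by simp
    exact (this.trans_lt ENNReal.one_lt_top).ne
  have hsnd : π.map Prod.snd = volume.withDensity p := by
    ext s hs
    rw [Measure.map_apply measurable_snd hs, hπ, withDensity_apply _ (measurable_snd hs),
      withDensity_apply _ hs, ← lintegral_indicator (measurable_snd hs),
      lintegral_prod_symm' _ (hwm.indicator (measurable_snd hs)), ← lintegral_indicator hs]
    refine lintegral_congr fun y => ?_
    by_cases hy : y ∈ s
    · rw [Set.indicator_of_mem hy]
      refine lintegral_congr fun x => ?_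
      rw [Set.indicator_of_mem (by exact hy)]
    · rw [Set.indicator_of_notMem hy]
      rw [← lintegral_zero (μ := μ)]
      refine lintegral_congr fun x => ?_
      rw [Set.indicator_of_notMem (by exact hy)]
  set Q := (π.map Prod.fst).prod (π.map Prod.snd) with hQ
  have hQ' : Q = m.withDensity (fun q => p q.2) := by
    rw [hQ, hfst, hsnd, prod_withDensity_right hpm]
  have hQprob : IsProbabilityMeasure Q := by
    have h1 := Measure.isProbabilityMeasure_map (μ := π) measurable_fst.aemeasurable
    have h2 := Measure.isProbabilityMeasure_map (μ := π) measurable_snd.aemeasurable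
    rw [hQ]; infer_instance
  have hdm : Measurable (fun q : (Fin nt → ℝ) × (Fin nr → ℝ) => w q / p q.2) :=
    hwm.div (hpm.comp measurable_snd)
  have hπQ : π = Q.withDensity (fun q => w q / p q.2) := by
    have hpm2 : Measurable (fun q : (Fin nt → ℝ) × (Fin nr → ℝ) => p q.2) := hpm.comp measurable_snd
    rw [hQ', ← withDensity_mul _ hpm2 hdm, hπ]
    congr 1
    ext q
    simp only [Pi.mul_apply]
    rw [ENNReal.mul_div_cancel (hp0 _) (hpt _)]
  have hac : π ≪ Q := hπQ ▸ withDensity_absolutelyContinuous _ _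
  have hrn : ∀ᵐ q ∂π, π.rnDeriv Q q = w q / p q.2 := by
    apply hac.ae_le
    have := Measure.rnDeriv_withDensity Q hdm
    rw [← hπQ] at this
    exact this
  have hpr : ∀ y, 0 < (p y).toReal := fun y => ENNReal.toReal_pos (hp0 y) (hpt y)
  have hlog : ∀ᵐ q ∂π, Real.log (π.rnDeriv Q q).toReal =
      Real.log (wr q) - Real.log (p q.2).toReal := by
    filter_upwards [hrn] with q hq
    rw [hq, ENNReal.toReal_div, Real.log_div _ (hpr _).ne']
    · simp only [hw]; rw [ENNReal.toReal_ofReal (gd_pos _).le]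
    · simp only [hw]; rw [ENNReal.toReal_ofReal (gd_pos _).le]; exact (gd_pos _).ne'
  set J : (Fin nt → ℝ) × (Fin nr → ℝ) → ℝ := fun q => Real.log (wr q) - Real.log (R q.2) with hJ
  have hJm : Measurable J := hwrm.log.sub (hR.comp measurable_snd).log
  have hJT : J ∘ T = fun q => Real.log (gd q.2) - Real.log (R (H *ᵥ q.1 + q.2)) := by
    ext q; simp [hJ, hT, hwr]
  have hJint : Integrable J π := by
    rw [hπT, integrable_map_measure hJm.aestronglyMeasurable hTm.aemeasurable, hJT]
    exact hint
  have hJB : ∫ q, J q ∂π ≤ B := by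
    rw [hπT, integral_map hTm.aemeasurable hJm.aestronglyMeasurable]
    have e : ∀ q, J (T q) = Real.log (gd q.2) - Real.log (R (H *ᵥ q.1 + q.2)) := fun q => congrFun hJT q
    simp_rw [e]
    rw [integral_prod _ hint]
    calc _ ≤ ∫ x, B ∂μ := integral_mono_ae hint.integral_prod_left (integrable_const _) hB
      _ = B := by simp
  have hRw := lintegral_to_real (P := π) (f := fun q => R q.2 / wr q)
    ((hR.comp measurable_snd).div hwrm) (fun q => (div_pos (hR0 _) (gd_pos _)).le) (by
      have hmm : Measurable (fun q : (Fin nt → ℝ) × (Fin nr → ℝ) => ENNReal.ofReal (R q.2 / wr q)) :=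
        ((hR.comp measurable_snd).div hwrm).ennreal_ofReal
      rw [hπ, lintegral_withDensity_eq_lintegral_mul _ hwm hmm]
      have e : ∀ q, (w * fun q => ENNReal.ofReal (R q.2 / wr q)) q = ENNReal.ofReal (R q.2) := by
        intro q
        simp only [Pi.mul_apply, hw]
        rw [← ENNReal.ofReal_mul (gd_pos _).le, mul_div_cancel₀ _ (gd_pos _).ne']
      simp_rw [e]
      have hmR : Measurable (fun q : (Fin nt → ℝ) × (Fin nr → ℝ) => ENNReal.ofReal (R q.2)) :=
        (hR.comp measurable_snd).ennreal_ofReal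
      rw [hm, lintegral_prod _ hmR.aemeasurable]
      simpa using hR1)
  have hRp := lintegral_to_real (P := π) (f := fun q => R q.2 / (p q.2).toReal)
    ((hR.comp measurable_snd).div (hpm.comp measurable_snd).ennreal_toReal)
    (fun q => (div_pos (hR0 _) (hpr _)).le) (by
      have hmm : Measurable (fun y => ENNReal.ofReal (R y / (p y).toReal)) :=
        (hR.div hpm.ennreal_toReal).ennreal_ofReal
      rw [← lintegral_map (f := fun y => ENNReal.ofReal (R y / (p y).toReal)) hmm measurable_snd, hsnd,
        lintegral_withDensity_eq_lintegral_mul _ hpm hmm]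
      have e : ∀ y, (p * fun y => ENNReal.ofReal (R y / (p y).toReal)) y = ENNReal.ofReal (R y) := by
        intro y
        simp only [Pi.mul_apply]
        conv_lhs => rw [← ENNReal.ofReal_toReal (hpt y)]
        rw [ENNReal.toReal_ofReal (hpr y).le, ← ENNReal.ofReal_mul (hpr y).le,
          mul_div_cancel₀ _ (hpr y).ne']
      simp_rw [e]
      exact hR1)
  have hlogle : ∀ a b : ℝ, 0 < a → 0 < b → Real.log a - Real.log b ≤ a / b - 1 := by
    intro a b ha hb
    rw [← Real.log_div ha.ne' hb.ne']
    exact Real.log_le_sub_one_of_pos (div_pos ha hb)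
  refine le_trans ?_ hJB
  unfold mutualInfoJoint klDivR
  rw [integral_congr_ae hlog]
  by_cases hI : Integrable (fun q => Real.log (wr q) - Real.log (p q.2).toReal) π
  · have h1 : ∫ q, (Real.log (wr q) - Real.log (p q.2).toReal) ∂π ≤
        ∫ q, (J q + (R q.2 / (p q.2).toReal - 1)) ∂π := by
      refine integral_mono hI (hJint.add (hRp.1.sub (integrable_const _))) fun q => ?_
      have := hlogle (R q.2) (p q.2).toReal (hR0 _) (hpr _)
      simp only [hJ]; linarith
    have hI2 : Integrable (fun q => R q.2 / (p q.2).toReal - 1) π := hRp.1.sub (integrable_const _)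
    rw [integral_add hJint hI2, integral_sub hRp.1 (integrable_const _)] at h1
    simp at h1
    linarith [hRp.2]
  · rw [integral_undef hI]
    have h1 : ∫ q, - J q ∂π ≤ ∫ q, (R q.2 / wr q - 1) ∂π := by
      refine integral_mono hJint.neg (hRw.1.sub (integrable_const _)) fun q => ?_
      have := hlogle (R q.2) (wr q) (hR0 _) (gd_pos _)
      simp only [hJ]; linarith
    rw [integral_neg, integral_sub hRw.1 (integrable_const _)] at h1
    simp at h1
    linarith [hRw.2]


/-! ### The auxiliary output density -/

/-- The variances `σ_{U,ℓ}²`. -/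
def vv (H : Matrix (Fin nr) (Fin nt) ℝ) (U : Finset (Fin nt)) (ℓ : Fin nr) : ℝ :=
  ((HU H U)⁻¹ * ((HU H U)⁻¹)ᵀ) ℓ ℓ

lemma vv_eq (H : Matrix (Fin nr) (Fin nt) ℝ) (U : Finset (Fin nt)) (ℓ : Fin nr) :
    vv H U ℓ = (HU H U)⁻¹ ℓ ⬝ᵥ (HU H U)⁻¹ ℓ := by
  unfold vv; rw [Matrix.mul_apply']; rfl

lemma vv_pos {H : Matrix (Fin nr) (Fin nt) ℝ} {U : Finset (Fin nt)} (hU : U ∈ goodSets H)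
    (ℓ : Fin nr) : 0 < vv H U ℓ := by
  rw [vv_eq]
  have h0 : 0 ≤ (HU H U)⁻¹ ℓ ⬝ᵥ (HU H U)⁻¹ ℓ :=
    Finset.sum_nonneg fun i _ => mul_self_nonneg _
  refine lt_of_le_of_ne h0 fun h => ?_
  have h1 : (HU H U)⁻¹ ℓ = 0 := dotProduct_self_eq_zero.mp h.symm
  have h2 : (HU H U)⁻¹ * HU H U = 1 := Matrix.nonsing_inv_mul _ (det_HU_ne_zero hU)
  have h3 := congrFun (congrFun h2 ℓ) ℓ
  rw [Matrix.mul_apply', h1, zero_dotProduct, Matrix.one_apply_eq] at h3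
  exact zero_ne_one h3

/-- The auxiliary output density attached to `U`, with base point `v`. -/
def RU (H : Matrix (Fin nr) (Fin nt) ℝ) (A : ℝ) (v : Fin nr → ℝ) (U : Finset (Fin nt))
    (y : Fin nr → ℝ) : ℝ :=
  |(HU H U).det|⁻¹ * ∏ ℓ, rdens A (vv H U ℓ) (((HU H U)⁻¹ *ᵥ (y - v)) ℓ)

lemma measurable_mulVec_s11 {k n : ℕ} (M : Matrix (Fin k) (Fin n) ℝ) :
    Measurable (fun x : Fin n → ℝ => M *ᵥ x) := by
  apply Continuous.measurable; unfold mulVec dotProduct; fun_prop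

lemma absdet_pos {H : Matrix (Fin nr) (Fin nt) ℝ} {U : Finset (Fin nt)} (hU : U ∈ goodSets H) :
    0 < |(HU H U).det| := abs_pos.mpr (det_HU_ne_zero hU).ne_zero

lemma measurable_RU (H : Matrix (Fin nr) (Fin nt) ℝ) (A : ℝ) (v : Fin nr → ℝ)
    (U : Finset (Fin nt)) : Measurable (RU H A v U) := by
  unfold RU
  refine Measurable.const_mul ?_ _
  refine Finset.measurable_prod _ fun ℓ _ => (measurable_rdens _ _).comp ?_
  exact (measurable_pi_apply ℓ).comp
    ((measurable_mulVec_s11 ((HU H U)⁻¹)).comp (measurable_id.sub measurable_const))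

lemma RU_pos {H : Matrix (Fin nr) (Fin nt) ℝ} {A : ℝ} (hA : 0 < A) (v : Fin nr → ℝ)
    {U : Finset (Fin nt)} (hU : U ∈ goodSets H) (y : Fin nr → ℝ) : 0 < RU H A v U y :=
  mul_pos (inv_pos.mpr (absdet_pos hU)) (Finset.prod_pos fun _ _ => rdens_pos hA _)

lemma log_RU {H : Matrix (Fin nr) (Fin nt) ℝ} {A : ℝ} (hA : 0 < A) (v : Fin nr → ℝ)
    {U : Finset (Fin nt)} (hU : U ∈ goodSets H) (y : Fin nr → ℝ) :
    Real.log (RU H A v U y) = - Real.log |(HU H U).det| - ∑ ℓ, Real.log (Kc A (vv H U ℓ))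
      + ∑ ℓ, pen A (vv H U ℓ) (((HU H U)⁻¹ *ᵥ (y - v)) ℓ) := by
  unfold RU
  rw [Real.log_mul (inv_pos.mpr (absdet_pos hU)).ne'
    (Finset.prod_pos fun _ _ => rdens_pos hA _).ne', Real.log_inv,
    Real.log_prod (fun _ _ => (rdens_pos hA _).ne')]
  simp_rw [log_rdens hA]
  rw [Finset.sum_add_distrib, Finset.sum_neg_distrib]
  ring

lemma lintegral_RU {H : Matrix (Fin nr) (Fin nt) ℝ} {A : ℝ} (hA : 0 < A) (v : Fin nr → ℝ)
    {U : Finset (Fin nt)} (hU : U ∈ goodSets H) :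
    ∫⁻ y, ENNReal.ofReal (RU H A v U y) = 1 := by
  have hd := absdet_pos hU
  let g : (Fin nr → ℝ) → ℝ := fun t => ∏ ℓ, rdens A (vv H U ℓ) (t ℓ)
  have hg0 : ∀ t, 0 ≤ g t := fun t => Finset.prod_nonneg fun _ _ => (rdens_pos hA _).le
  have hgm : Measurable g := Finset.measurable_prod _ fun ℓ _ =>
    (measurable_rdens _ _).comp (measurable_pi_apply ℓ)
  have hgi : Integrable g volume :=
    Integrable.fintype_prod fun ℓ => (integrable_rdens hA (vv_pos hU ℓ)).1
  have hg1 : ∫⁻ t, ENNReal.ofReal (g t) = 1 := by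
    rw [← ofReal_integral_eq_lintegral_ofReal hgi (Eventually.of_forall hg0)]
    have : ∫ t, g t = 1 := by
      show ∫ t : Fin nr → ℝ, ∏ ℓ, rdens A (vv H U ℓ) (t ℓ) = 1
      rw [integral_fintype_prod_volume_eq_prod (fun ℓ => rdens A (vv H U ℓ))]
      exact Finset.prod_eq_one fun ℓ _ => (integrable_rdens hA (vv_pos hU ℓ)).2
    rw [this, ENNReal.ofReal_one]
  have e : ∀ y, ENNReal.ofReal (RU H A v U y) =
      ENNReal.ofReal |(HU H U).det|⁻¹ * ENNReal.ofReal (g ((HU H U)⁻¹ *ᵥ (y - v))) := by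
    intro y
    rw [← ENNReal.ofReal_mul (inv_pos.mpr hd).le]
    rfl
  simp_rw [e]
  rw [lintegral_const_mul' _ _ ENNReal.ofReal_ne_top,
    lintegral_sub_right_eq_self (fun y => ENNReal.ofReal (g ((HU H U)⁻¹ *ᵥ y))) v]
  have hdi : ((HU H U)⁻¹).det ≠ 0 := by
    rw [Matrix.det_nonsing_inv, Ring.inverse_eq_inv']
    exact inv_ne_zero (det_HU_ne_zero hU).ne_zero
  have hmap := Real.map_matrix_volume_pi_eq_smul_volume_pi hdi
  have h2 : ∫⁻ y, ENNReal.ofReal (g ((HU H U)⁻¹ *ᵥ y)) =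
      ∫⁻ t, ENNReal.ofReal (g t) ∂(Measure.map (⇑(Matrix.toLin' (HU H U)⁻¹)) volume) := by
    rw [lintegral_map hgm.ennreal_ofReal]
    · simp only [Matrix.toLin'_apply]
    · exact measurable_mulVec_s11 _
  rw [h2, hmap, lintegral_smul_measure, hg1, Matrix.det_nonsing_inv, Ring.inverse_eq_inv', inv_inv,
    smul_eq_mul, mul_one, ← ENNReal.ofReal_mul (inv_pos.mpr hd).le, inv_mul_cancel₀ hd.ne',
    ENNReal.ofReal_one]

lemma RU_le {H : Matrix (Fin nr) (Fin nt) ℝ} {A : ℝ} (hA : 0 < A) (v : Fin nr → ℝ)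
    {U : Finset (Fin nt)} (hU : U ∈ goodSets H) : ∃ C : ℝ, ∀ y, RU H A v U y ≤ C := by
  refine ⟨Real.exp (- Real.log |(HU H U).det| - ∑ ℓ, Real.log (Kc A (vv H U ℓ))
      + ∑ ℓ : Fin nr, 1 / 2), fun y => ?_⟩
  rw [← Real.log_le_iff_le_exp (RU_pos hA v hU y), log_RU hA v hU]
  have : ∑ ℓ, pen A (vv H U ℓ) (((HU H U)⁻¹ *ᵥ (y - v)) ℓ) ≤ ∑ ℓ : Fin nr, (1 / 2 : ℝ) :=
    Finset.sum_le_sum fun ℓ _ => pen_le hA (vv_pos hU ℓ) _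
  linarith

/-- The finite set of good index sets. -/
def GS (H : Matrix (Fin nr) (Fin nt) ℝ) : Finset (Finset (Fin nt)) :=
  (Set.toFinite (goodSets H)).toFinset

lemma mem_GS {H : Matrix (Fin nr) (Fin nt) ℝ} {U : Finset (Fin nt)} :
    U ∈ GS H ↔ U ∈ goodSets H := by simp [GS]

/-- Mixture of the auxiliary output densities. -/
def Rmix (H : Matrix (Fin nr) (Fin nt) ℝ) (A : ℝ) (v : Finset (Fin nt) → (Fin nr → ℝ))
    (w : Finset (Fin nt) → ℝ) (y : Fin nr → ℝ) : ℝ :=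
  ∑ U ∈ GS H, w U * RU H A (v U) U y

lemma measurable_Rmix (H : Matrix (Fin nr) (Fin nt) ℝ) (A : ℝ)
    (v : Finset (Fin nt) → (Fin nr → ℝ)) (w : Finset (Fin nt) → ℝ) : Measurable (Rmix H A v w) := by
  unfold Rmix
  exact Finset.measurable_sum _ fun U _ => (measurable_RU _ _ _ _).const_mul _

lemma le_Rmix {H : Matrix (Fin nr) (Fin nt) ℝ} {A : ℝ} (hA : 0 < A)
    (v : Finset (Fin nt) → (Fin nr → ℝ)) {w : Finset (Fin nt) → ℝ} (hw : ∀ U ∈ goodSets H, 0 < w U)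
    {U : Finset (Fin nt)} (hU : U ∈ goodSets H) (y : Fin nr → ℝ) :
    w U * RU H A (v U) U y ≤ Rmix H A v w y := by
  unfold Rmix
  refine Finset.single_le_sum (f := fun U => w U * RU H A (v U) U y) (fun V hV => ?_) (mem_GS.mpr hU)
  exact (mul_pos (hw V (mem_GS.mp hV)) (RU_pos hA _ (mem_GS.mp hV) y)).le

lemma lintegral_Rmix {H : Matrix (Fin nr) (Fin nt) ℝ} {A : ℝ} (hA : 0 < A)
    (v : Finset (Fin nt) → (Fin nr → ℝ)) {w : Finset (Fin nt) → ℝ} (hw : ∀ U ∈ goodSets H, 0 < w U)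
    (hw1 : ∑ U ∈ GS H, w U = 1) :
    ∫⁻ y, ENNReal.ofReal (Rmix H A v w y) ≤ 1 := by
  have e : ∀ y, ENNReal.ofReal (Rmix H A v w y) =
      ∑ U ∈ GS H, ENNReal.ofReal (w U) * ENNReal.ofReal (RU H A (v U) U y) := by
    intro y
    unfold Rmix
    rw [ENNReal.ofReal_sum_of_nonneg fun V hV =>
      (mul_pos (hw V (mem_GS.mp hV)) (RU_pos hA _ (mem_GS.mp hV) y)).le]
    exact Finset.sum_congr rfl fun V hV => ENNReal.ofReal_mul (hw V (mem_GS.mp hV)).le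
  simp_rw [e]
  rw [lintegral_finsetSum _ fun U _ => ((measurable_RU _ _ _ _).ennreal_ofReal).const_mul _]
  have : ∀ U ∈ GS H, ∫⁻ y, ENNReal.ofReal (w U) * ENNReal.ofReal (RU H A (v U) U y) =
      ENNReal.ofReal (w U) := by
    intro U hU
    rw [lintegral_const_mul' _ _ ENNReal.ofReal_ne_top, lintegral_RU hA _ (mem_GS.mp hU), mul_one]
  rw [Finset.sum_congr rfl this, ← ENNReal.ofReal_sum_of_nonneg fun V hV => (hw V (mem_GS.mp hV)).le,
    hw1, ENNReal.ofReal_one]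

lemma integrable_core {H : Matrix (Fin nr) (Fin nt) ℝ} (hrank : H.rank = nr) {A : ℝ} (hA : 0 < A)
    (v : Finset (Fin nt) → (Fin nr → ℝ)) {w : Finset (Fin nt) → ℝ} (hw : ∀ U ∈ goodSets H, 0 < w U)
    (μ : Measure (Fin nt → ℝ)) [IsProbabilityMeasure μ]
    (hμ : ∀ᵐ x ∂μ, ∀ k, x k ∈ Set.Icc (0 : ℝ) A) :
    Integrable (fun q : (Fin nt → ℝ) × (Fin nr → ℝ) =>
      Real.log (gd q.2) - Real.log (Rmix H A v w (H *ᵥ q.1 + q.2))) (μ.prod (stdGaussian nr)) := by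
  obtain ⟨U, hU⟩ := goodSets_nonempty hrank
  refine (integrable_log_gd.comp_snd μ).sub ?_
  have hpos : ∀ y, 0 < Rmix H A v w y := fun y =>
    (mul_pos (hw U hU) (RU_pos hA _ hU y)).trans_le (le_Rmix hA v hw hU y)
  have hub : ∃ C : ℝ, ∀ y, Rmix H A v w y ≤ C := by
    have : ∀ V, ∃ C : ℝ, V ∈ goodSets H → ∀ y, RU H A (v V) V y ≤ C := by
      intro V
      by_cases hV : V ∈ goodSets H
      · obtain ⟨C, hC⟩ := RU_le hA (v V) hV
        exact ⟨C, fun _ => hC⟩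
      · exact ⟨0, fun h => absurd h hV⟩
    choose C hC using this
    refine ⟨∑ V ∈ GS H, w V * C V, fun y => Finset.sum_le_sum fun V hV => ?_⟩
    exact mul_le_mul_of_nonneg_left (hC V (mem_GS.mp hV) y) (hw V (mem_GS.mp hV)).le
  obtain ⟨C, hC⟩ := hub
  set c0 : ℝ := Real.log (w U) + (- Real.log |(HU H U).det| - ∑ ℓ, Real.log (Kc A (vv H U ℓ)))
    with hc0
  have hlow : ∀ y, c0 - ∑ ℓ, (((HU H U)⁻¹ *ᵥ (y - v U)) ℓ) ^ 2 / vv H U ℓ ≤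
      Real.log (Rmix H A v w y) := by
    intro y
    have h1 := Real.log_le_log (mul_pos (hw U hU) (RU_pos hA _ hU y)) (le_Rmix hA v hw hU y)
    rw [Real.log_mul (hw U hU).ne' (RU_pos hA _ hU y).ne', log_RU hA _ hU] at h1
    have h2 : ∑ ℓ, - ((((HU H U)⁻¹ *ᵥ (y - v U)) ℓ) ^ 2 / vv H U ℓ) ≤
        ∑ ℓ, pen A (vv H U ℓ) (((HU H U)⁻¹ *ᵥ (y - v U)) ℓ) :=
      Finset.sum_le_sum fun ℓ _ => pen_ge hA (vv_pos hU ℓ) _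
    rw [Finset.sum_neg_distrib] at h2
    rw [hc0]; linarith
  have hTm : Measurable (fun q : (Fin nt → ℝ) × (Fin nr → ℝ) => H *ᵥ q.1 + q.2) :=
    ((measurable_mulVec_s11 H).comp measurable_fst).add measurable_snd
  have hx : ∀ k, MemLp (fun q : (Fin nt → ℝ) × (Fin nr → ℝ) => q.1 k) 2
      (μ.prod (stdGaussian nr)) := by
    intro k
    refine MemLp.comp_fst (f := fun x : Fin nt → ℝ => x k) ?_ _
    refine MemLp.of_bound (measurable_pi_apply k).aestronglyMeasurable A ?_
    filter_upwards [hμ] with x hx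
    rw [Real.norm_eq_abs, abs_of_nonneg (hx k).1]; exact (hx k).2
  have hy : ∀ j, MemLp (fun q : (Fin nt → ℝ) × (Fin nr → ℝ) => (H *ᵥ q.1 + q.2 - v U) j) 2
      (μ.prod (stdGaussian nr)) := by
    intro j
    have h1 : MemLp (fun q : (Fin nt → ℝ) × (Fin nr → ℝ) => ∑ k, H j k * q.1 k) 2
      (μ.prod (stdGaussian nr)) := memLp_finsetSum _ fun k _ => (hx k).const_mul _
    exact (h1.add ((memLp_coord j).comp_snd μ)).sub (memLp_const (v U j))
  have hM : ∀ ℓ, MemLp (fun q : (Fin nt → ℝ) × (Fin nr → ℝ) =>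
      ((HU H U)⁻¹ *ᵥ (H *ᵥ q.1 + q.2 - v U)) ℓ) 2 (μ.prod (stdGaussian nr)) := by
    intro ℓ
    exact memLp_finsetSum (f := fun j (q : (Fin nt → ℝ) × (Fin nr → ℝ)) =>
      (HU H U)⁻¹ ℓ j * (H *ᵥ q.1 + q.2 - v U) j) Finset.univ fun j _ => (hy j).const_mul _
  have hS : Integrable (fun q : (Fin nt → ℝ) × (Fin nr → ℝ) =>
      |Real.log C| + (|c0| + ∑ ℓ, (((HU H U)⁻¹ *ᵥ (H *ᵥ q.1 + q.2 - v U)) ℓ) ^ 2 / vv H U ℓ))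
      (μ.prod (stdGaussian nr)) :=
    (integrable_const _).add ((integrable_const _).add
      (integrable_finsetSum _ fun ℓ _ => (hM ℓ).integrable_sq.div_const _))
  refine hS.mono' ((measurable_Rmix H A v w).comp hTm).log.aestronglyMeasurable
    (Eventually.of_forall fun q => ?_)
  have h1 := hlow (H *ᵥ q.1 + q.2)
  have h2 := Real.log_le_log (hpos (H *ᵥ q.1 + q.2)) (hC _)
  have h3 : 0 ≤ ∑ ℓ, (((HU H U)⁻¹ *ᵥ (H *ᵥ q.1 + q.2 - v U)) ℓ) ^ 2 / vv H U ℓ :=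
    Finset.sum_nonneg fun ℓ _ => div_nonneg (sq_nonneg _) (vv_pos hU ℓ).le
  have h4 := le_abs_self (Real.log C)
  have h5 := neg_abs_le c0
  have h6 := abs_nonneg c0
  have h7 := abs_nonneg (Real.log C)
  rw [Real.norm_eq_abs, abs_le]
  constructor <;> linarith

/-- Unnormalized optimal weights. -/
def eU (H : Matrix (Fin nr) (Fin nt) ℝ) (A : ℝ) (U : Finset (Fin nt)) : ℝ :=
  |(HU H U).det| * ∏ ℓ, (sigmaUl H U ℓ + A / Real.sqrt (2 * Real.pi * Real.exp 1))

lemma sigma_term_pos (H : Matrix (Fin nr) (Fin nt) ℝ) {A : ℝ} (hA : 0 < A) (U : Finset (Fin nt))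
    (ℓ : Fin nr) : 0 < sigmaUl H U ℓ + A / Real.sqrt (2 * Real.pi * Real.exp 1) := by
  have h1 : 0 ≤ sigmaUl H U ℓ := Real.sqrt_nonneg _
  positivity

lemma eU_pos {H : Matrix (Fin nr) (Fin nt) ℝ} {A : ℝ} (hA : 0 < A) {U : Finset (Fin nt)}
    (hU : U ∈ goodSets H) : 0 < eU H A U :=
  mul_pos (absdet_pos hU) (Finset.prod_pos fun ℓ _ => sigma_term_pos H hA U ℓ)

lemma log_eU {H : Matrix (Fin nr) (Fin nt) ℝ} {A : ℝ} (hA : 0 < A) {U : Finset (Fin nt)}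
    (hU : U ∈ goodSets H) : Real.log (eU H A U) = Real.log |(HU H U).det| +
      ∑ ℓ, Real.log (sigmaUl H U ℓ + A / Real.sqrt (2 * Real.pi * Real.exp 1)) := by
  unfold eU
  rw [Real.log_mul (absdet_pos hU).ne' (Finset.prod_pos fun ℓ _ => sigma_term_pos H hA U ℓ).ne',
    Real.log_prod fun ℓ _ => (sigma_term_pos H hA U ℓ).ne']

lemma log_Kc (H : Matrix (Fin nr) (Fin nt) ℝ) {A : ℝ} (hA : 0 < A) (U : Finset (Fin nt))
    (ℓ : Fin nr) : Real.log (Kc A (vv H U ℓ)) = Real.log (Real.sqrt (2 * Real.pi * Real.exp 1)) +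
      Real.log (sigmaUl H U ℓ + A / Real.sqrt (2 * Real.pi * Real.exp 1)) := by
  have hc : 0 < Real.sqrt (2 * Real.pi * Real.exp 1) := by positivity
  rw [← Real.log_mul hc.ne' (sigma_term_pos H hA U ℓ).ne']
  congr 1
  have : sigmaUl H U ℓ = Real.sqrt (vv H U ℓ) := rfl
  rw [this]
  unfold Kc
  field_simp
  ring

lemma pen_std {H : Matrix (Fin nr) (Fin nt) ℝ} {A : ℝ} {U : Finset (Fin nt)}
    (hU : U ∈ goodSets H) (ℓ : Fin nr) (s : ℝ) (hs : s ∈ Set.Icc 0 A) :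
    Integrable (fun z => pen A (vv H U ℓ) (s + ((HU H U)⁻¹ *ᵥ z) ℓ)) (stdGaussian nr) ∧
      0 ≤ ∫ z, pen A (vv H U ℓ) (s + ((HU H U)⁻¹ *ᵥ z) ℓ) ∂(stdGaussian nr) := by
  have hv := vv_pos hU ℓ
  obtain ⟨u, hu⟩ : ∃ u : ℝ≥0, (u : ℝ) = vv H U ℓ := ⟨⟨_, hv.le⟩, rfl⟩
  have hu0 : u ≠ 0 := by
    intro h; rw [h] at hu; simp at hu; linarith
  have h1 := pen_gauss A u s hu0 hs
  have h2 := stdGaussian_map_dot ((HU H U)⁻¹ ℓ) u (hu.trans (vv_eq H U ℓ))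
  have hm : Measurable (fun z : Fin nr → ℝ => (HU H U)⁻¹ ℓ ⬝ᵥ z) := by
    apply Continuous.measurable; unfold dotProduct; fun_prop
  have hpm : Measurable (fun g => pen A u (s + g)) :=
    (measurable_pen A u).comp (measurable_const.add measurable_id)
  rw [← h2, integrable_map_measure hpm.aestronglyMeasurable hm.aemeasurable,
    integral_map hm.aemeasurable hpm.aestronglyMeasurable, hu] at h1
  exact h1

lemma point_bound {H : Matrix (Fin nr) (Fin nt) ℝ} {A : ℝ} (hA : 0 < A)
    (v : Finset (Fin nt) → (Fin nr → ℝ)) {w : Finset (Fin nt) → ℝ} (hw : ∀ U ∈ goodSets H, 0 < w U)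
    (B : ℝ) (hB : ∀ U ∈ goodSets H, Real.log (eU H A U) - Real.log (w U) ≤ B)
    {x : Fin nt → ℝ} {U : Finset (Fin nt)} (hU : U ∈ goodSets H) {s : Fin nr → ℝ}
    (hs : ∀ i, s i ∈ Set.Icc 0 A) (hx : H *ᵥ x = v U + HU H U *ᵥ s)
    (hint : Integrable (fun z => Real.log (gd z) - Real.log (Rmix H A v w (H *ᵥ x + z)))
      (stdGaussian nr)) :
    ∫ z, (Real.log (gd z) - Real.log (Rmix H A v w (H *ᵥ x + z))) ∂(stdGaussian nr) ≤ B := by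
  set c0 : ℝ := Real.log (w U) - Real.log |(HU H U).det| - ∑ ℓ, Real.log (Kc A (vv H U ℓ)) with hc0
  have hy : ∀ z, (HU H U)⁻¹ *ᵥ (H *ᵥ x + z - v U) = s + (HU H U)⁻¹ *ᵥ z := by
    intro z
    have : H *ᵥ x + z - v U = HU H U *ᵥ s + z := by rw [hx]; abel
    rw [this, mulVec_add, mulVec_mulVec, Matrix.nonsing_inv_mul _ (det_HU_ne_zero hU), one_mulVec]
  have hle : ∀ z, Real.log (gd z) - Real.log (Rmix H A v w (H *ᵥ x + z)) ≤
      Real.log (gd z) - (c0 + ∑ ℓ, pen A (vv H U ℓ) (s ℓ + ((HU H U)⁻¹ *ᵥ z) ℓ)) := by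
    intro z
    have h1 := Real.log_le_log (mul_pos (hw U hU) (RU_pos hA _ hU (H *ᵥ x + z)))
      (le_Rmix hA v hw hU (H *ᵥ x + z))
    rw [Real.log_mul (hw U hU).ne' (RU_pos hA _ hU _).ne', log_RU hA _ hU, hy] at h1
    simp only [Pi.add_apply] at h1
    rw [hc0]; linarith
  have hpi : Integrable (fun z => ∑ ℓ, pen A (vv H U ℓ) (s ℓ + ((HU H U)⁻¹ *ᵥ z) ℓ))
      (stdGaussian nr) := integrable_finsetSum _ fun ℓ _ => (pen_std hU ℓ _ (hs ℓ)).1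
  have hp2 : Integrable (fun z => c0 + ∑ ℓ, pen A (vv H U ℓ) (s ℓ + ((HU H U)⁻¹ *ᵥ z) ℓ))
      (stdGaussian nr) := (integrable_const c0).add hpi
  have h3 := integral_mono hint (integrable_log_gd.sub hp2) hle
  have h4 : ∫ z, (Real.log (gd z) - (c0 + ∑ ℓ, pen A (vv H U ℓ) (s ℓ + ((HU H U)⁻¹ *ᵥ z) ℓ)))
      ∂(stdGaussian nr) = - (nr * Real.log (Real.sqrt (2 * Real.pi * Real.exp 1))) -
        (c0 + ∑ ℓ, ∫ z, pen A (vv H U ℓ) (s ℓ + ((HU H U)⁻¹ *ᵥ z) ℓ) ∂(stdGaussian nr)) := by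
    rw [integral_sub integrable_log_gd hp2, integral_log_gd, integral_add (integrable_const c0) hpi,
      integral_finsetSum _ fun ℓ _ => (pen_std hU ℓ _ (hs ℓ)).1]
    simp
  have h5 : 0 ≤ ∑ ℓ, ∫ z, pen A (vv H U ℓ) (s ℓ + ((HU H U)⁻¹ *ᵥ z) ℓ) ∂(stdGaussian nr) :=
    Finset.sum_nonneg fun ℓ _ => (pen_std hU ℓ _ (hs ℓ)).2
  have h6 := hB U hU
  rw [log_eU hA hU] at h6
  have h7 : ∑ ℓ, Real.log (Kc A (vv H U ℓ)) =
      nr * Real.log (Real.sqrt (2 * Real.pi * Real.exp 1)) +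
      ∑ ℓ, Real.log (sigmaUl H U ℓ + A / Real.sqrt (2 * Real.pi * Real.exp 1)) := by
    simp_rw [log_Kc H hA U]
    rw [Finset.sum_add_distrib]; simp
  have h8 := h3.trans_eq h4
  rw [hc0, h7] at h8
  linarith

lemma sum_eU_pos {H : Matrix (Fin nr) (Fin nt) ℝ} (hrank : H.rank = nr) {A : ℝ} (hA : 0 < A) :
    0 < ∑ U ∈ GS H, eU H A U := by
  obtain ⟨U, hU⟩ := goodSets_nonempty hrank
  exact Finset.sum_pos (fun V hV => eU_pos hA (mem_GS.mp hV)) ⟨U, mem_GS.mpr hU⟩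

lemma mutualInfo_le_log {H : Matrix (Fin nr) (Fin nt) ℝ} (hrank : H.rank = nr) {A : ℝ} (hA : 0 < A)
    (μ : Measure (Fin nt → ℝ)) [IsProbabilityMeasure μ]
    (hμ : ∀ᵐ x ∂μ, ∀ k, x k ∈ Set.Icc (0 : ℝ) A) :
    mutualInfoJoint (jointLaw H μ) ≤ Real.log (∑ U ∈ GS H, eU H A U) := by
  obtain ⟨v, hv⟩ := exists_cover hrank hA
  have hS := sum_eU_pos hrank hA
  set S := ∑ U ∈ GS H, eU H A U with hSdef
  set w : Finset (Fin nt) → ℝ := fun U => eU H A U / S with hwdef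
  have hw : ∀ U ∈ goodSets H, 0 < w U := fun U hU => div_pos (eU_pos hA hU) hS
  have hw1 : ∑ U ∈ GS H, w U = 1 := by
    simp only [hwdef]
    rw [← Finset.sum_div, ← hSdef, div_self hS.ne']
  have hint := integrable_core hrank hA v hw μ hμ
  obtain ⟨U₀, hU₀⟩ := goodSets_nonempty hrank
  refine mutualInfo_le H μ (Rmix H A v w) (measurable_Rmix H A v w) (fun y =>
    (mul_pos (hw U₀ hU₀) (RU_pos hA _ hU₀ y)).trans_le (le_Rmix hA v hw hU₀ y))
    (lintegral_Rmix hA v hw hw1) _ hint ?_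
  filter_upwards [hμ, hint.prod_right_ae] with x hx hi
  obtain ⟨U, hU, s, hs, hxs⟩ := hv x hx
  refine point_bound hA v hw _ (fun V hV => ?_) hU hs hxs hi
  simp only [hwdef]
  rw [Real.log_div (eU_pos hA hV).ne' hS.ne']
  linarith

lemma obj_eq {H : Matrix (Fin nr) (Fin nt) ℝ} (hrank : H.rank = nr) {A : ℝ} (hA : 0 < A)
    {p : Finset (Fin nt) → ℝ} (hp : ProbVec H p) :
    Real.log (VH H) - Dkl H p (qU H) + ∑ᶠ U ∈ goodSets H, p U *
      ∑ ℓ, Real.log (sigmaUl H U ℓ + A / Real.sqrt (2 * Real.pi * Real.exp 1)) =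
    ∑ U ∈ GS H, p U * (Real.log (eU H A U) - Real.log (p U)) := by
  obtain ⟨-, -, hp1⟩ := hp
  have hV : 0 < VH H := by
    unfold VH
    rw [finsum_mem_eq_finite_toFinset_sum _ (Set.toFinite (goodSets H))]
    obtain ⟨U, hU⟩ := goodSets_nonempty hrank
    exact Finset.sum_pos (fun V hV => absdet_pos (mem_GS.mp hV)) ⟨U, mem_GS.mpr hU⟩
  unfold Dkl
  rw [finsum_mem_eq_finite_toFinset_sum _ (Set.toFinite (goodSets H))] at hp1
  rw [finsum_mem_eq_finite_toFinset_sum _ (Set.toFinite (goodSets H)),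
    finsum_mem_eq_finite_toFinset_sum _ (Set.toFinite (goodSets H))]
  change ∑ U ∈ GS H, p U = 1 at hp1
  change _ - ∑ U ∈ GS H, _ + ∑ U ∈ GS H, _ = _
  have e : Real.log (VH H) = ∑ U ∈ GS H, p U * Real.log (VH H) := by
    rw [← Finset.sum_mul, hp1, one_mul]
  rw [e, ← Finset.sum_sub_distrib, ← Finset.sum_add_distrib]
  refine Finset.sum_congr rfl fun U hU => ?_
  have hU' := mem_GS.mp hU
  rw [log_eU hA hU']
  by_cases h0 : p U = 0
  · simp [h0]
  · have hd := absdet_pos hU'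
    unfold qU
    rw [Real.log_div h0 (div_pos hd hV).ne', Real.log_div hd.ne' hV.ne']
    ring

lemma gibbs {ι : Type*} (G : Finset ι) (p e : ι → ℝ) (hp0 : ∀ i, 0 ≤ p i)
    (he : ∀ i ∈ G, 0 < e i) :
    ∑ i ∈ G, p i * (Real.log (e i) - Real.log (p i)) ≤ ∑ i ∈ G, e i := by
  refine Finset.sum_le_sum fun i hi => ?_
  rcases (hp0 i).eq_or_lt with h | h
  · rw [← h, zero_mul]; exact (he i hi).le
  · rw [← Real.log_div (he i hi).ne' h.ne']
    have h1 := Real.log_le_sub_one_of_pos (div_pos (he i hi) h)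
    calc p i * Real.log (e i / p i) ≤ p i * (e i / p i - 1) := by gcongr
      _ = e i - p i := by field_simp
      _ ≤ e i := by linarith

lemma main_bound (H : Matrix (Fin nr) (Fin nt) ℝ) (hrank : H.rank = nr)
    (A α : ℝ) (hA : 0 < A) (hα : 0 < α) :
    capacity H A (α * A) ≤
      sSup { c | ∃ p : Finset (Fin nt) → ℝ, ProbVec H p ∧
        c = Real.log (VH H) - Dkl H p (qU H)
          + ∑ᶠ U ∈ goodSets H, p U *
              ∑ ℓ, Real.log (sigmaUl H U ℓ
                + A / Real.sqrt (2 * Real.pi * Real.exp 1)) } := by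
  classical
  have hS := sum_eU_pos hrank hA
  refine le_trans (b := Real.log (∑ U ∈ GS H, eU H A U)) ?_ ?_
  · refine csSup_le ?_ ?_
    · refine ⟨_, Measure.dirac 0, ⟨inferInstance, ?_, ?_⟩, rfl⟩
      · rw [ae_dirac_eq]
        simp [hA.le]
      · rw [integral_dirac]
        simp; positivity
    · rintro c ⟨μ, ⟨hμ1, hμ2, -⟩, rfl⟩
      exact mutualInfo_le_log hrank hA μ hμ2
  · refine le_csSup ?_ ?_
    · refine ⟨∑ U ∈ GS H, eU H A U, ?_⟩
      rintro c ⟨p, hp, rfl⟩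
      rw [obj_eq hrank hA hp]
      exact gibbs _ _ _ hp.1 fun U hU => eU_pos hA (mem_GS.mp hU)
    · set S := ∑ U ∈ GS H, eU H A U with hSdef
      set w : Finset (Fin nt) → ℝ := fun U => if U ∈ goodSets H then eU H A U / S else 0 with hwdef
      have hwG : ∀ U ∈ GS H, w U = eU H A U / S := fun U hU => by
        simp only [hwdef]; rw [if_pos (mem_GS.mp hU)]
      have hw1 : ∑ U ∈ GS H, w U = 1 := by
        rw [Finset.sum_congr rfl hwG, ← Finset.sum_div, ← hSdef, div_self hS.ne']
      have hp : ProbVec H w := by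
        refine ⟨fun U => ?_, fun U hU => ?_, ?_⟩
        · simp only [hwdef]
          split_ifs with h
          · exact (div_pos (eU_pos hA h) hS).le
          · exact le_rfl
        · simp only [hwdef]; rw [if_neg hU]
        · rw [finsum_mem_eq_finite_toFinset_sum _ (Set.toFinite (goodSets H))]
          exact hw1
      refine ⟨w, hp, ?_⟩
      rw [obj_eq hrank hA hp]
      have : ∀ U ∈ GS H, w U * (Real.log (eU H A U) - Real.log (w U)) = w U * Real.log S := by
        intro U hU
        rw [hwG U hU, Real.log_div (eU_pos hA (mem_GS.mp hU)).ne' hS.ne']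
        ring
      rw [Finset.sum_congr rfl this, ← Finset.sum_mul, hw1, one_mul]


end MimoOptical

/-- For arbitrary `α > 0`,
`C_H(A, αA) ≤ sup_p [ log V_H − D(p‖q) + Σ_U p_U Σ_ℓ log(σ_{U,ℓ} + A/√(2πe)) ]`. -/
theorem MimoOptical.capacity_upper_bound_peak
    (nt nr : ℕ) (hnr : 1 ≤ nr) (hntnr : nr < nt)
    (H : Matrix (Fin nr) (Fin nt) ℝ) (hrank : H.rank = nr)
    (A α : ℝ) (hA : 0 < A) (hα : 0 < α) :
    MimoOptical.capacity H A (α * A) ≤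
      sSup { c | ∃ p : Finset (Fin nt) → ℝ, MimoOptical.ProbVec H p ∧
        c = Real.log (MimoOptical.VH H) - MimoOptical.Dkl H p (MimoOptical.qU H)
          + ∑ᶠ U ∈ MimoOptical.goodSets H, p U *
              ∑ ℓ, Real.log (MimoOptical.sigmaUl H U ℓ
                + A / Real.sqrt (2 * Real.pi * Real.exp 1)) } := by
  exact MimoOptical.main_bound H hrank A α hA hα
end
end
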